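/- Fix a₀ ∈ ℂ ∖ {0} with a₀ ∉ closure(P_∞), and let U = {a ∈ ℂ ∖ {0} : a ∉ closure(P_∞)}. Then the closure of A_∞ moves holomorphically over U: there exists a map φ : U × (closure(A_∞(a₀)) ∖ {∞}) → ℂ such that φ(a₀, z) = z for all z; for each fixed z the map a ↦ φ(a, z) is holomorphic on U; for each fixed a ∈ U the map z ↦ φ(a, z) is injective; and for each a ∈ U, φ(a, ·) maps A_∞(a₀) ∖ {∞} onto A_∞(a) ∖ {∞} and maps the frontier of A_∞(a₀) onto the frontier of A_∞(a). -/

import Mathlib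

open Filter Topology OnePoint

/-- The Riemann sphere as the one-point compactification of `ℂ`. -/
notation "RSphere" => OnePoint ℂ

/-- The quadratic rational map `R_a(z) = a/(z² + 2z)` on the Riemann sphere, with
`R_a(0) = R_a(−2) = ∞` and `R_a(∞) = 0`. -/
noncomputable def Rhat (a : ℂ) : RSphere → RSphere := fun z =>
  match z with
  | ∞ => ((0 : ℂ) : RSphere)
  | (w : ℂ) => if w ^ 2 + 2 * w = 0 then ∞ else ((a / (w ^ 2 + 2 * w) : ℂ) : RSphere)

/-- The basin of attraction of the superattracting 2-cycle `∞ ↦ 0 ↦ ∞` of `R_a`. -/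
def sphereBasin (a : ℂ) : Set RSphere :=
  {z | Tendsto (fun n => (Rhat a)^[2 * n] z) atTop (𝓝 ∞) ∨
       Tendsto (fun n => (Rhat a)^[2 * n] z) atTop (𝓝 ((0 : ℂ) : RSphere))}

/-- `A_∞(a)`: the connected component of the basin containing `∞`. -/
noncomputable def Ainf (a : ℂ) : Set RSphere := connectedComponentIn (sphereBasin a) ∞

/-- `A_0(a)`: the connected component of the basin containing `0`. -/
noncomputable def Azero (a : ℂ) : Set RSphere :=
  connectedComponentIn (sphereBasin a) ((0 : ℂ) : RSphere)

/-- `P_∞`: the parameters for which the critical value `−a` lies in `A_∞(a)`. -/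
def Pinf : Set ℂ := {a | a ≠ 0 ∧ (((-a : ℂ) : RSphere) ∈ Ainf a)}

open Metric

lemma exists_log_ball {f : ℂ → ℂ} {c : ℂ} {r : ℝ} (hf : DifferentiableOn ℂ f (ball c r))
    (hne : ∀ z ∈ ball c r, f z ≠ 0) :
    ∃ g : ℂ → ℂ, DifferentiableOn ℂ g (ball c r) ∧ ∀ z ∈ ball c r, Complex.exp (g z) = f z := by
  rcases le_or_gt r 0 with hr | hr
  · refine ⟨f, hf, fun z hz => ?_⟩
    rw [ball_eq_empty.2 hr] at hz
    exact hz.elim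
  have hc : c ∈ ball c r := mem_ball_self hr
  have hd : DifferentiableOn ℂ (fun z => deriv f z / f z) (ball c r) :=
    (hf.deriv isOpen_ball).div hf hne
  obtain ⟨g, hg0, hg⟩ := (hd.isExactOn_ball).with_val_at c (Complex.log (f c))
  have hgd : DifferentiableOn ℂ g (ball c r) := fun z hz =>
    (hg z hz).differentiableAt.differentiableWithinAt
  refine ⟨g, hgd, ?_⟩
  have hconst : ∀ z ∈ ball c r, f z * Complex.exp (-(g z)) = f c * Complex.exp (-(g c)) := by
    intro z hz
    refine isOpen_ball.is_const_of_deriv_eq_zero (convex_ball c r).isPreconnected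
      (f := fun z => f z * Complex.exp (-(g z))) (𝕜 := ℂ) ?_ ?_ hz hc
    · exact hf.mul hgd.neg.cexp
    · intro w hw
      have h1 : HasDerivAt f (deriv f w) w :=
        (hf.differentiableAt (isOpen_ball.mem_nhds hw)).hasDerivAt
      have h2 := h1.mul ((hg w hw).neg.cexp)
      have h3 : deriv (fun z => f z * Complex.exp (-(g z))) w = _ := h2.deriv
      rw [h3]
      have := hne w hw
      simp only [Pi.zero_apply]
      field_simp
      ring
  intro z hz
  have h := hconst z hz
  rw [hg0, Complex.exp_neg, Complex.exp_neg, Complex.exp_log (hne c hc),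
    mul_inv_cancel₀ (hne c hc)] at h
  have h3 := Complex.exp_ne_zero (g z)
  field_simp at h
  exact h.symm

lemma exists_sqrt_ball {f : ℂ → ℂ} {c : ℂ} {r : ℝ} (hr : 0 < r)
    (hf : DifferentiableOn ℂ f (ball c r))
    (hne : ∀ z ∈ ball c r, f z ≠ 0) (w : ℂ) (hw : w ^ 2 = f c) :
    ∃ g : ℂ → ℂ, DifferentiableOn ℂ g (ball c r) ∧ (∀ z ∈ ball c r, g z ^ 2 = f z) ∧ g c = w := by
  obtain ⟨g, hg, he⟩ := exists_log_ball hf hne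
  have hsq : ∀ z ∈ ball c r, Complex.exp (g z / 2) ^ 2 = f z := by
    intro z hz
    rw [← he z hz, ← Complex.exp_nat_mul]
    congr 1
    push_cast
    ring
  have hd : DifferentiableOn ℂ (fun z => Complex.exp (g z / 2)) (ball c r) :=
    (hg.div_const 2).cexp
  have hc : c ∈ ball c r := mem_ball_self hr
  have h1 := hsq c hc
  rw [← hw] at h1
  rcases sq_eq_sq_iff_eq_or_eq_neg.1 h1 with h | h
  · exact ⟨_, hd, hsq, h⟩
  · refine ⟨fun z => -Complex.exp (g z / 2), hd.neg, fun z hz => ?_, ?_⟩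
    · rw [neg_sq]; exact hsq z hz
    · show -Complex.exp (g c / 2) = w
      rw [h, neg_neg]

lemma harnack_ball {h : ℂ → ℂ} {c : ℂ} {R M : ℝ} (hR : 0 < R)
    (hd : DifferentiableOn ℂ h (ball c R)) (hne : ∀ z ∈ ball c R, h z ≠ 0)
    (hM : ∀ z ∈ ball c R, ‖h z‖ < M) {a : ℂ} (ha : dist a c ≤ R / 2) :
    ‖h a‖ ≤ M * (‖h c‖ / M) ^ (1 / 3 : ℝ) := by
  have hc : c ∈ ball c R := mem_ball_self hR
  have haR : a ∈ ball c R := by rw [mem_ball]; linarith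
  have hM0 : 0 < M := lt_of_le_of_lt (norm_nonneg _) (hM c hc)
  obtain ⟨g, hg, he⟩ := exists_log_ball (f := fun z => h z / M) (hd.div_const _)
    (fun z hz => div_ne_zero (hne z hz) (by exact_mod_cast hM0.ne'))
  have hnorm : ∀ z ∈ ball c R, Real.exp (g z).re = ‖h z‖ / M := by
    intro z hz
    rw [← Complex.norm_exp, he z hz, norm_div, Complex.norm_real, Real.norm_of_nonneg hM0.le]
  have hre : ∀ z ∈ ball c R, (g z).re < 0 := by
    intro z hz
    rw [← Real.exp_lt_one_iff, hnorm z hz, div_lt_one hM0]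
    exact hM z hz
  set w : ℂ → ℂ := fun z => (g z - g c) / (g z + (starRingEnd ℂ) (g c)) with hw
  have hden : ∀ z ∈ ball c R, g z + (starRingEnd ℂ) (g c) ≠ 0 := by
    intro z hz h0
    have := congrArg Complex.re h0
    simp at this
    linarith [hre z hz, hre c hc]
  have hwd : DifferentiableOn ℂ w (ball c R) :=
    (hg.sub_const _).div (hg.add_const _) hden
  have hwc : w c = 0 := by simp [hw]
  have hmaps : Set.MapsTo w (ball c R) (closedBall (w c) 1) := by
    intro z hz
    rw [hwc, mem_closedBall, dist_zero_right, hw]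
    simp only
    rw [norm_div, div_le_one (norm_pos_iff.2 (hden z hz))]
    rw [← sq_le_sq₀ (norm_nonneg _) (norm_nonneg _), ← Complex.normSq_eq_norm_sq,
      ← Complex.normSq_eq_norm_sq, Complex.normSq_apply, Complex.normSq_apply]
    simp
    nlinarith [hre z hz, hre c hc, mul_pos_of_neg_of_neg (hre z hz) (hre c hc)]
  have hs := Complex.dist_le_div_mul_dist_of_mapsTo_ball hwd hmaps haR
  rw [hwc, dist_zero_right] at hs
  have hs2 : ‖w a‖ ≤ 1 / 2 := by
    refine hs.trans ?_
    rw [div_mul_eq_mul_div, one_mul, div_le_iff₀ hR]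
    linarith
  rw [hw] at hs2
  simp only at hs2
  rw [norm_div, div_le_iff₀ (norm_pos_iff.2 (hden a haR)),
    ← sq_le_sq₀ (norm_nonneg _) (by positivity), mul_pow, ← Complex.normSq_eq_norm_sq,
      ← Complex.normSq_eq_norm_sq, Complex.normSq_apply, Complex.normSq_apply] at hs2
  simp at hs2
  have hxa := hre a haR
  have hxc := hre c hc
  have key : (g a).re ≤ (g c).re * (1 / 3) := by
    by_contra hcon
    push Not at hcon
    nlinarith [sq_nonneg ((g a).im - (g c).im), mul_pos_of_neg_of_neg hxa hxc]
  have h1 : ‖h a‖ / M ≤ (‖h c‖ / M) ^ (1 / 3 : ℝ) := by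
    rw [← hnorm a haR, ← hnorm c hc, ← Real.exp_mul]
    exact Real.exp_le_exp.2 key
  rw [div_le_iff₀ hM0] at h1
  linarith

lemma harnack_eps {M : ℝ} (hM0 : 0 < M) {ε : ℝ} (hε : 0 < ε) : ∃ δ > 0,
    ∀ {h : ℂ → ℂ} {c : ℂ} {R : ℝ}, 0 < R →
    DifferentiableOn ℂ h (ball c R) → (∀ z ∈ ball c R, h z ≠ 0) →
    (∀ z ∈ ball c R, ‖h z‖ < M) → ‖h c‖ < δ → ∀ a, dist a c ≤ R / 2 → ‖h a‖ < ε := by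
  refine ⟨M * (ε / M) ^ (3 : ℝ), by positivity, ?_⟩
  intro h c R hR hd hne hM hc a ha
  refine (harnack_ball hR hd hne hM ha).trans_lt ?_
  have h1 : ‖h c‖ / M < (ε / M) ^ (3 : ℝ) := by
    rw [div_lt_iff₀ hM0]; linarith
  have h2 : (‖h c‖ / M) ^ (1 / 3 : ℝ) < ((ε / M) ^ (3 : ℝ)) ^ (1 / 3 : ℝ) :=
    Real.rpow_lt_rpow (by positivity) h1 (by norm_num)
  rw [← Real.rpow_mul (by positivity)] at h2
  norm_num at h2
  calc M * (‖h c‖ / M) ^ (1 / 3 : ℝ) < M * (ε / M) := by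
        have := mul_lt_mul_of_pos_left h2 hM0
        norm_num at this ⊢
        exact this
    _ = ε := by field_simp

lemma earle_hamilton_aux {Q K : Set ℂ} (hQ : IsOpen Q) {f : ℂ → ℂ}
    (hf : DifferentiableOn ℂ f Q) (hfK : Set.MapsTo f Q K) (hKQ : K ⊆ Q) {δ ε M : ℝ}
    (hε : Metric.thickening ε K ⊆ Q) (hεM : Metric.thickening ε K ⊆ closedBall 0 M)
    (hδ : 0 < δ) (hδε : ∀ x ∈ K, ∀ y ∈ K, δ * dist x y < ε) {x : ℂ} (hx : x ∈ Q) (n : ℕ) :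
    ∃ g : ℂ → ℂ, DifferentiableOn ℂ g Q ∧ Set.MapsTo g Q (closedBall 0 M ∩ Q) ∧
      g x = f^[n + 1] x ∧ DifferentiableAt ℂ f^[n + 1] x ∧
      deriv g x = (1 + δ) ^ (n + 1) * deriv f^[n + 1] x := by
  have hit : ∀ n, f^[n] x ∈ Q := by
    intro n
    induction n with
    | zero => exact hx
    | succ n ih => rw [Function.iterate_succ_apply']; exact hKQ (hfK ih)
  -- the perturbed maps
  have hmap : ∀ x₁ ∈ Q, Set.MapsTo (fun y => f y + δ * (f y - f x₁)) Q (closedBall 0 M ∩ Q) := by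
    intro x₁ hx₁ y hy
    have : f y + δ * (f y - f x₁) ∈ Metric.thickening ε K := by
      rw [Metric.mem_thickening_iff]
      refine ⟨f y, hfK hy, ?_⟩
      have h := hδε _ (hfK hy) _ (hfK hx₁)
      rw [dist_eq_norm] at h ⊢
      simpa [abs_of_pos hδ] using h
    exact ⟨hεM this, hε this⟩
  have hdiff : ∀ x₁ : ℂ, DifferentiableOn ℂ (fun y => f y + δ * (f y - f x₁)) Q := by
    intro x₁
    exact hf.add ((hf.sub_const _).const_mul _)
  have hder : ∀ x₁ ∈ Q, HasDerivAt (fun y => f y + δ * (f y - f x₁)) ((1 + δ) * deriv f x₁) x₁ := by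
    intro x₁ hx₁
    have h1 : HasDerivAt f (deriv f x₁) x₁ :=
      (hf.differentiableAt (hQ.mem_nhds hx₁)).hasDerivAt
    have h2 := h1.add ((h1.sub_const (f x₁)).const_mul (δ : ℂ))
    exact h2.congr_deriv (by ring)
  induction n with
  | zero =>
    refine ⟨fun y => f y + δ * (f y - f x), hdiff x, hmap x hx, by simp,
      by simpa using hf.differentiableAt (hQ.mem_nhds hx), ?_⟩
    rw [(hder x hx).deriv]
    simp
  | succ n ih =>
    obtain ⟨g, hg, hgm, hgx, hdn, hgd⟩ := ih
    have hx₁ : f^[n + 1] x ∈ Q := hit (n + 1)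
    have hgxd : HasDerivAt g (deriv g x) x := (hg.differentiableAt (hQ.mem_nhds hx)).hasDerivAt
    have hfd : HasDerivAt f (deriv f (f^[n + 1] x)) (f^[n + 1] x) :=
      (hf.differentiableAt (hQ.mem_nhds hx₁)).hasDerivAt
    have hcomp : HasDerivAt f^[n + 2] (deriv f (f^[n + 1] x) * deriv f^[n + 1] x) x := by
      rw [Function.iterate_succ' f (n + 1)]
      exact hfd.comp x hdn.hasDerivAt
    refine ⟨(fun y => f y + δ * (f y - f (f^[n + 1] x))) ∘ g,
      (hdiff _).comp hg (fun y hy => (hgm hy).2), ?_, ?_, hcomp.differentiableAt, ?_⟩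
    · intro y hy
      exact hmap _ hx₁ (hgm hy).2
    · simp only [Function.comp, hgx, sub_self, mul_zero, add_zero]
      rw [Function.iterate_succ_apply' f (n + 1)]
    · have h3 := hder _ hx₁
      have h4 : HasDerivAt ((fun y => f y + δ * (f y - f (f^[n + 1] x))) ∘ g)
          ((1 + δ) * deriv f (f^[n + 1] x) * deriv g x) x := by
        refine HasDerivAt.comp x ?_ hgxd
        rw [hgx]
        exact h3
      rw [h4.deriv, hgd, hcomp.deriv]
      ring

lemma earle_hamilton {Q K : Set ℂ} (hQ : IsOpen Q) (hQc : IsPreconnected Q) (hQn : Q.Nonempty)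
    {f : ℂ → ℂ} (hf : DifferentiableOn ℂ f Q) (hfK : Set.MapsTo f Q K) (hKQ : K ⊆ Q)
    (hK : IsCompact K) : ∃ p ∈ Q, f p = p := by
  obtain ⟨ε, hε0, hε⟩ := hK.exists_thickening_subset_open hQ hKQ
  obtain ⟨M, hM⟩ := (hK.isBounded.thickening (δ := ε)).subset_closedBall (0 : ℂ)
  obtain ⟨D, hD⟩ := Metric.isBounded_iff.1 hK.isBounded
  obtain ⟨δ, hδ0, hδ⟩ : ∃ δ : ℝ, 0 < δ ∧ ∀ x ∈ K, ∀ y ∈ K, δ * dist x y < ε := by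
    refine ⟨ε / (|D| + 1), by positivity, fun x hx y hy => ?_⟩
    have h1 : dist x y ≤ D := hD hx hy
    have h2 := le_abs_self D
    rw [div_mul_eq_mul_div, div_lt_iff₀ (by positivity)]
    nlinarith
  set lam : ℝ := (1 + δ)⁻¹ with hlam
  have hlam0 : 0 < lam := by positivity
  have hlam1 : lam < 1 := inv_lt_one_of_one_lt₀ (by linarith)
  have hder : ∀ x ∈ Q, ∀ ρ > 0, ball x ρ ⊆ Q → ∀ n : ℕ, DifferentiableAt ℂ f^[n + 1] x ∧
      ‖deriv f^[n + 1] x‖ ≤ 2 * M / ρ * lam ^ (n + 1) := by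
    intro x hx ρ hρ hball n
    obtain ⟨g, hg, hgm, hgx, hdn, hgd⟩ := earle_hamilton_aux hQ hf hfK hKQ hε hM hδ0 hδ hx n
    refine ⟨hdn, ?_⟩
    have h1 : ‖deriv g x‖ ≤ 2 * M / ρ := by
      refine Complex.norm_deriv_le_div_of_mapsTo_ball (hg.mono hball) ?_ hρ
      intro y hy
      have h2 := (hgm (hball hy)).1
      have h3 := (hgm hx).1
      rw [mem_closedBall, dist_zero_right] at h2 h3
      rw [mem_closedBall, dist_eq_norm]
      linarith [norm_sub_le (g y) (g x)]
    rw [hgd, norm_mul, norm_pow] at h1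
    have h4 : ‖(1 + δ : ℂ)‖ = 1 + δ := by
      rw [← Complex.ofReal_one, ← Complex.ofReal_add, Complex.norm_real, Real.norm_of_nonneg]
      positivity
    rw [h4] at h1
    rw [hlam, inv_pow, ← div_eq_mul_inv, le_div_iff₀ (by positivity)]
    linarith
  let P : ℂ → ℂ → Prop := fun x y => ∃ C : ℝ, ∀ n : ℕ,
    dist (f^[n + 1] x) (f^[n + 1] y) ≤ C * lam ^ n
  have hP : ∀ x ∈ Q, ∀ y ∈ Q, P x y := by
    intro x hx y hy
    refine hQc.induction₂' P ?_ ?_ hx hy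
    · intro x hx
      obtain ⟨ρ, hρ, hball⟩ := Metric.isOpen_iff.1 hQ x hx
      have hnear : ∀ y ∈ ball x (ρ / 2), P x y := by
        intro y hy
        refine ⟨2 * M / (ρ / 2) * lam * dist x y, fun n => ?_⟩
        have hb : ∀ z ∈ ball x (ρ / 2), DifferentiableAt ℂ f^[n + 1] z ∧
          ‖deriv f^[n + 1] z‖ ≤ 2 * M / (ρ / 2) * lam ^ (n + 1) := by
          intro z hz
          have hzb : ball z (ρ / 2) ⊆ ball x ρ := by
            refine ball_subset_ball' ?_
            rw [mem_ball] at hz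
            linarith
          exact hder z (hball (ball_subset_ball (by linarith) hz)) (ρ / 2) (by positivity)
            (hzb.trans hball) n
        have h5 := Convex.norm_image_sub_le_of_norm_deriv_le (𝕜 := ℂ) (fun z hz => (hb z hz).1)
          (fun z hz => (hb z hz).2) (convex_ball x (ρ / 2)) hy (mem_ball_self (by positivity))
        rw [← dist_eq_norm, ← dist_eq_norm] at h5
        refine h5.trans (le_of_eq ?_)
        ring
      have hmem : ball x (ρ / 2) ∈ 𝓝[Q] x :=
        mem_nhdsWithin_of_mem_nhds (ball_mem_nhds x (by positivity))
      filter_upwards [hmem] with y hy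
      obtain ⟨C, hC⟩ := hnear y hy
      exact ⟨⟨C, hC⟩, ⟨C, fun n => by rw [dist_comm]; exact hC n⟩⟩
    · rintro x y z _ _ _ ⟨C, hC⟩ ⟨C', hC'⟩
      refine ⟨C + C', fun n => ?_⟩
      rw [add_mul]
      exact (dist_triangle _ _ _).trans (add_le_add (hC n) (hC' n))
  obtain ⟨x, hx⟩ := hQn
  obtain ⟨C, hC⟩ := hP x hx (f x) (hKQ (hfK hx))
  have hcau : CauchySeq (fun n => f^[n + 1] x) := by
    refine cauchySeq_of_le_geometric lam C hlam1 fun n => ?_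
    rw [Function.iterate_succ_apply f (n + 1)]
    exact hC n
  have hmemK : ∀ n, f^[n + 1] x ∈ K := by
    intro n
    induction n with
    | zero => exact hfK hx
    | succ n ih => rw [Function.iterate_succ_apply']; exact hfK (hKQ ih)
  obtain ⟨p, hpK, hp⟩ := cauchySeq_tendsto_of_isComplete hK.isComplete hmemK hcau
  refine ⟨p, hKQ hpK, ?_⟩
  have hcont : ContinuousAt f p :=
    (hf.differentiableAt (hQ.mem_nhds (hKQ hpK))).continuousAt
  have h6 : Tendsto (fun n => f (f^[n + 1] x)) atTop (𝓝 (f p)) := hcont.tendsto.comp hp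
  have h7 : Tendsto (fun n => f (f^[n + 1] x)) atTop (𝓝 p) := by
    have := (tendsto_add_atTop_iff_nat 1).2 hp
    refine this.congr fun n => ?_
    rw [Function.iterate_succ_apply' f (n + 1)]
  exact tendsto_nhds_unique h6 h7

lemma isPreconnected_annulus (s t : ℝ) (hs : 0 ≤ s) :
    IsPreconnected {u : ℂ | s < ‖u‖ ∧ ‖u‖ < t} := by
  have h : {u : ℂ | s < ‖u‖ ∧ ‖u‖ < t} =
      (fun p : ℝ × ℝ => (p.1 : ℂ) * Complex.exp (p.2 * Complex.I)) ''
        (Set.Ioo s t ×ˢ Set.univ) := by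
    ext u
    constructor
    · intro hu
      exact ⟨(‖u‖, u.arg), ⟨hu, trivial⟩, Complex.norm_mul_exp_arg_mul_I u⟩
    · rintro ⟨⟨r, θ⟩, ⟨hr, -⟩, rfl⟩
      have : ‖(r : ℂ) * Complex.exp (θ * Complex.I)‖ = r := by
        rw [norm_mul, Complex.norm_exp_ofReal_mul_I, mul_one, Complex.norm_real,
          Real.norm_of_nonneg (hs.trans hr.1.le)]
      simp only [Set.mem_ofPred_eq, this]
      exact hr
  rw [h]
  refine (isPreconnected_Ioo.prod isPreconnected_univ).image _ ?_
  fun_prop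

lemma isPreconnected_compl_image {Y : ℂ → ℂ} {s t : ℝ} (hs : 0 ≤ s) (hst : s < t)
    (hY : DifferentiableOn ℂ Y (ball 0 t)) (hinj : Set.InjOn Y (ball 0 t))
    (hopen : IsOpen (Y '' ball 0 t)) : IsPreconnected (Y '' closedBall 0 s)ᶜ := by
  set C := Y '' closedBall 0 s with hC
  have hsub : closedBall (0 : ℂ) s ⊆ ball 0 t := closedBall_subset_ball hst
  have hCc : IsCompact C := (isCompact_closedBall _ _).image_of_continuousOn
    (hY.continuousOn.mono hsub)
  have hCo : IsOpen Cᶜ := hCc.isClosed.isOpen_compl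
  set A := Y '' {u : ℂ | s < ‖u‖ ∧ ‖u‖ < t} with hA
  have hAball : {u : ℂ | s < ‖u‖ ∧ ‖u‖ < t} ⊆ ball 0 t := fun u hu => by
    simpa using hu.2
  have hAc : IsPreconnected A := (isPreconnected_annulus s t hs).image _
    (hY.continuousOn.mono hAball)
  have hAC : A ⊆ Cᶜ := by
    rintro _ ⟨u, hu, rfl⟩ ⟨v, hv, hvu⟩
    have := hinj (hsub hv) (hAball hu) hvu
    rw [this] at hv
    simp at hv
    linarith [hu.1]
  have hmeet : ∀ y ∈ Cᶜ, A ⊆ connectedComponentIn Cᶜ y := by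
    intro y hy
    set W := connectedComponentIn Cᶜ y with hW
    have hWo : IsOpen W := hCo.connectedComponentIn
    have hWne : W ≠ Set.univ := by
      intro h
      have h0 : Y 0 ∈ C := ⟨0, by simpa using hs, rfl⟩
      have h1 : Y 0 ∈ W := by rw [h]; trivial
      exact connectedComponentIn_subset _ _ h1 h0
    have hyW : y ∈ W := mem_connectedComponentIn hy
    obtain ⟨x, hx⟩ := nonempty_frontier_iff.2 ⟨⟨y, hyW⟩, hWne⟩
    have hxC : x ∈ C := by
      by_contra hxC
      have hxo : IsOpen (connectedComponentIn Cᶜ x) := hCo.connectedComponentIn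
      have hxm : x ∈ connectedComponentIn Cᶜ x := mem_connectedComponentIn hxC
      obtain ⟨w, hw1, hw2⟩ := mem_closure_iff.1 hx.1 _ hxo hxm
      have e1 := connectedComponentIn_eq hw1
      have e2 := connectedComponentIn_eq hw2
      have : x ∈ W := by rw [hW, e2, ← e1]; exact hxm
      exact hx.2 (by rwa [hWo.interior_eq])
    obtain ⟨u, hu, rfl⟩ := hxC
    obtain ⟨w, ⟨v, hv, rfl⟩, hw2⟩ := mem_closure_iff.1 hx.1 _ hopen ⟨u, hsub hu, rfl⟩
    have hvA : Y v ∈ A := by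
      refine ⟨v, ⟨?_, by simpa using hv⟩, rfl⟩
      by_contra hcon
      exact connectedComponentIn_subset _ _ hw2 ⟨v, by simpa using hcon, rfl⟩
    rw [hW, connectedComponentIn_eq hw2]
    exact hAc.subset_connectedComponentIn hvA hAC
  have hx0 : Y (((s + t) / 2 : ℝ) : ℂ) ∈ A := by
    refine ⟨_, ?_, rfl⟩
    have : ‖(((s + t) / 2 : ℝ) : ℂ)‖ = (s + t) / 2 := by
      rw [Complex.norm_real, Real.norm_of_nonneg (by linarith)]
    simp only [Set.mem_ofPred_eq, this]
    constructor <;> linarith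
  refine isPreconnected_of_forall (Y (((s + t) / 2 : ℝ) : ℂ)) fun y hy => ?_
  exact ⟨connectedComponentIn Cᶜ y, connectedComponentIn_subset _ _, hmeet y hy hx0,
    mem_connectedComponentIn hy, isPreconnected_connectedComponentIn⟩

/-- A pair of local Boettcher parametrizations: `X` parametrizes (the inverse of) a
neighbourhood of infinity and `Y` a neighbourhood of zero. -/
structure BPair (a : ℂ) (r : ℝ) (X Y : ℂ → ℂ) : Prop where
  r_pos : 0 < r
  r_le : r ≤ 1
  ha : a ≠ 0
  dX : DifferentiableOn ℂ X (ball 0 r)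
  dY : DifferentiableOn ℂ Y (ball 0 r)
  X0 : X 0 = 0
  Y0 : Y 0 = 0
  dX0 : HasDerivAt X (1 / 2) 0
  e1 : ∀ u ∈ ball (0 : ℂ) r, Y u ^ 2 + 2 * Y u = a * X u
  e2 : ∀ u ∈ ball (0 : ℂ) r, a * X u ^ 2 = Y (u ^ 2) * (1 + 2 * X u)

lemma tendsto_pow_two_pow {u : ℂ} (hu : ‖u‖ < 1) :
    Tendsto (fun n : ℕ => u ^ (2 ^ n)) atTop (𝓝 0) :=
  (tendsto_pow_atTop_nhds_zero_of_norm_lt_one hu).comp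
    (tendsto_pow_atTop_atTop_of_one_lt (by norm_num))

namespace BPair

variable {a : ℂ} {r : ℝ} {X Y : ℂ → ℂ}

lemma zero_mem (h : BPair a r X Y) : (0 : ℂ) ∈ ball (0 : ℂ) r := mem_ball_self h.r_pos

lemma lt_one (h : BPair a r X Y) {u : ℂ} (hu : u ∈ ball (0 : ℂ) r) : ‖u‖ < 1 := by
  have := h.r_le
  rw [mem_ball_zero_iff] at hu
  linarith

lemma sq_mem (h : BPair a r X Y) {u : ℂ} (hu : u ∈ ball (0 : ℂ) r) : u ^ 2 ∈ ball (0 : ℂ) r := by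
  have h1 := h.lt_one hu
  rw [mem_ball_zero_iff] at hu ⊢
  rw [norm_pow]
  nlinarith [norm_nonneg u]

lemma pow_mem (h : BPair a r X Y) {u : ℂ} (hu : u ∈ ball (0 : ℂ) r) (n : ℕ) :
    u ^ (2 ^ n) ∈ ball (0 : ℂ) r := by
  induction n with
  | zero => simpa using hu
  | succ n ih => rw [pow_succ, pow_mul]; exact h.sq_mem ih

lemma neg_mem' {u : ℂ} (hu : u ∈ ball (0 : ℂ) r) : -u ∈ ball (0 : ℂ) r := by
  simpa using hu

lemma contX (h : BPair a r X Y) : ContinuousAt X 0 :=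
  h.dX0.continuousAt

lemma contY (h : BPair a r X Y) : ContinuousAt Y 0 :=
  (h.dY.differentiableAt (isOpen_ball.mem_nhds h.zero_mem)).continuousAt

lemma tendsX (h : BPair a r X Y) {u : ℂ} (hu : u ∈ ball (0 : ℂ) r) :
    Tendsto (fun n : ℕ => X (u ^ (2 ^ n))) atTop (𝓝 0) := by
  have := h.contX.tendsto.comp (tendsto_pow_two_pow (h.lt_one hu))
  rwa [h.X0] at this

lemma tendsY (h : BPair a r X Y) {u : ℂ} (hu : u ∈ ball (0 : ℂ) r) :
    Tendsto (fun n : ℕ => Y (u ^ (2 ^ n))) atTop (𝓝 0) := by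
  have := h.contY.tendsto.comp (tendsto_pow_two_pow (h.lt_one hu))
  rwa [h.Y0] at this

lemma dY0 (h : BPair a r X Y) : HasDerivAt Y (a / 4) 0 := by
  have h1 : HasDerivAt Y (deriv Y 0) 0 :=
    (h.dY.differentiableAt (isOpen_ball.mem_nhds h.zero_mem)).hasDerivAt
  have h2 := ((h1.pow 2).add (h1.const_mul 2))
  have h3 := h.dX0.const_mul a
  have heq : (Y ^ 2 + fun y => 2 * Y y) =ᶠ[𝓝 0] fun y => a * X y := by
    filter_upwards [isOpen_ball.mem_nhds h.zero_mem] with u hu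
    exact h.e1 u hu
  have h4 := (h3.congr_of_eventuallyEq heq).unique h2
  rw [h.Y0] at h4
  have h5 : deriv Y 0 = a / 4 := by
    simp at h4
    linear_combination (-1 / 2) * h4
  rwa [h5] at h1

lemma meet_step (h : BPair a r X Y) {u v : ℂ} (hu : u ∈ ball (0 : ℂ) r) (hv : v ∈ ball (0 : ℂ) r)
    (he : X u * Y v = 1) : X v * Y (u ^ 2) = 1 := by
  have h1 := h.e2 u hu
  have h2 := h.e1 v hv
  have h3 : a * (X v * Y (u ^ 2) - 1) = 0 := by
    linear_combination (-Y (u ^ 2)) * h2 - Y v ^ 2 * h1 + (a * (X u * Y v + 1) - Y (u^2) * 2 * Y v) * he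
  have h4 := (mul_eq_zero.1 h3).resolve_left h.ha
  linear_combination h4

lemma not_meet (h : BPair a r X Y) {u v : ℂ} (hu : u ∈ ball (0 : ℂ) r)
    (hv : v ∈ ball (0 : ℂ) r) : X u * Y v ≠ 1 := by
  intro he
  have hall : ∀ n : ℕ, X (u ^ (2 ^ n)) * Y (v ^ (2 ^ n)) = 1 := by
    intro n
    induction n with
    | zero => simpa using he
    | succ n ih =>
      rw [pow_succ 2 n, pow_mul, pow_mul]
      exact h.meet_step (h.pow_mem hv n) (h.sq_mem (h.pow_mem hu n))
        (h.meet_step (h.pow_mem hu n) (h.pow_mem hv n) ih)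
  have h1 := (h.tendsX hu).mul (h.tendsY hv)
  simp only [hall, mul_zero] at h1
  exact one_ne_zero (tendsto_nhds_unique tendsto_const_nhds h1)

lemma X_ne_zero (h : BPair a r X Y) {u : ℂ} (hu : u ∈ ball (0 : ℂ) r) (hu0 : u ≠ 0) :
    X u ≠ 0 := by
  intro h0
  have hall : ∀ n : ℕ, X (u ^ (2 ^ n)) = 0 := by
    intro n
    induction n with
    | zero => simpa using h0
    | succ n ih =>
      rw [pow_succ 2 n, pow_mul]
      have h1 := h.e2 _ (h.pow_mem hu n)
      rw [ih] at h1
      have h2 := h.e1 _ (h.sq_mem (h.pow_mem hu n))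
      have h3 : Y ((u ^ 2 ^ n) ^ 2) = 0 := by linear_combination (-1 : ℂ) * h1
      rw [h3] at h2
      have h4 : a * X ((u ^ 2 ^ n) ^ 2) = 0 := by rw [← h2]; ring
      exact (mul_eq_zero.1 h4).resolve_left h.ha
  have h5 : ∀ᶠ z in 𝓝[≠] (0 : ℂ), X z ≠ 0 := h.dX0.eventually_ne (by norm_num)
  have h6 : Tendsto (fun n : ℕ => u ^ (2 ^ n)) atTop (𝓝[≠] 0) :=
    tendsto_nhdsWithin_iff.2 ⟨tendsto_pow_two_pow (h.lt_one hu),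
      Eventually.of_forall fun n => pow_ne_zero _ hu0⟩
  obtain ⟨n, hn⟩ := (h6.eventually h5).exists
  exact hn (hall n)

lemma Y_ne_zero (h : BPair a r X Y) {u : ℂ} (hu : u ∈ ball (0 : ℂ) r) (hu0 : u ≠ 0) :
    Y u ≠ 0 := by
  intro h0
  have h1 := h.e1 u hu
  rw [h0] at h1
  have h4 : a * X u = 0 := by rw [← h1]; ring
  exact h.X_ne_zero hu hu0 ((mul_eq_zero.1 h4).resolve_left h.ha)

lemma one_add_ne (h : BPair a r X Y) {u : ℂ} (hu : u ∈ ball (0 : ℂ) r) : 1 + 2 * X u ≠ 0 := by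
  intro h0
  have h1 := h.e2 u hu
  rw [h0, mul_zero] at h1
  have h2 := pow_eq_zero_iff (two_ne_zero) |>.1 ((mul_eq_zero.1 h1).resolve_left h.ha)
  rw [h2] at h0
  norm_num at h0

lemma bound (h : BPair a r X Y) {u : ℂ} (hu : u ∈ ball (0 : ℂ) r) :
    ‖X u‖ ≤ max 1 (36 / ‖a‖) := by
  by_contra hcon
  push Not at hcon
  have ha0 : 0 < ‖a‖ := norm_pos_iff.2 h.ha
  set B := max 1 (36 / ‖a‖) with hB
  have hB1 : 1 ≤ B := le_max_left _ _
  have hB2 : 36 ≤ B * ‖a‖ := by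
    have : 36 / ‖a‖ ≤ B := le_max_right _ _
    rwa [div_le_iff₀ ha0] at this
  have hall : ∀ n : ℕ, B < ‖X (u ^ (2 ^ n))‖ := by
    intro n
    induction n with
    | zero => simpa using hcon
    | succ n ih =>
      rw [pow_succ 2 n, pow_mul]
      set w := u ^ 2 ^ n with hw
      have hwm : w ∈ ball (0 : ℂ) r := h.pow_mem hu n
      have h1 := congrArg norm (h.e2 w hwm)
      have h2 := congrArg norm (h.e1 _ (h.sq_mem hwm))
      rw [norm_mul, norm_mul, norm_pow] at h1
      have h2' : ‖Y (w ^ 2)‖ * ‖Y (w ^ 2) + 2‖ = ‖a‖ * ‖X (w ^ 2)‖ := by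
        rw [← norm_mul, ← norm_mul, ← h.e1 _ (h.sq_mem hwm)]
        congr 1
        ring
      set x := ‖X w‖
      set y := ‖Y (w ^ 2)‖
      have h3 : ‖1 + 2 * X w‖ ≤ 3 * x := by
        refine (norm_add_le _ _).trans ?_
        rw [norm_mul]
        norm_num
        change 1 + 2 * x ≤ 3 * x
        linarith
      have h4 : y - 2 ≤ ‖Y (w ^ 2) + 2‖ := by
        have := norm_sub_norm_le (Y (w ^ 2)) (-2)
        simpa using this
      have hx0 : 0 < x := by linarith
      have hy0 : 0 ≤ y := norm_nonneg _
      have h5 : ‖a‖ * x ≤ 3 * y := by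
        have : ‖a‖ * x ^ 2 ≤ y * (3 * x) := by
          rw [h1]; exact mul_le_mul_of_nonneg_left h3 hy0
        nlinarith
      have h6 : 36 < 3 * y := by nlinarith
      have h7 : y * (y / 2) ≤ ‖a‖ * ‖X (w ^ 2)‖ := by
        rw [← h2']
        exact mul_le_mul_of_nonneg_left (by linarith) hy0
      have h8 : ‖a‖ * x < ‖a‖ * ‖X (w ^ 2)‖ := by nlinarith
      exact ih.trans (lt_of_mul_lt_mul_left h8 ha0.le)
  have h1 := (h.tendsX hu).norm
  rw [norm_zero] at h1
  obtain ⟨n, hn⟩ := (h1.eventually (gt_mem_nhds (show (0 : ℝ) < 1 by norm_num))).exists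
  linarith [hall n]

lemma sum_eq (h : BPair a r X Y) {u : ℂ} (hu : u ∈ ball (0 : ℂ) r) :
    X u + X (-u) + 2 * X u * X (-u) = 0 := by
  have hneg : DifferentiableOn ℂ (fun u => X (-u)) (ball 0 r) :=
    h.dX.comp differentiable_neg.differentiableOn (fun u hu => neg_mem' hu)
  have hA : AnalyticOnNhd ℂ (fun u => X u + X (-u) + 2 * X u * X (-u)) (ball 0 r) :=
    DifferentiableOn.analyticOnNhd ((h.dX.add hneg).add ((h.dX.const_mul 2).mul hneg)) isOpen_ball
  have hd : HasDerivAt (fun u => X u - X (-u)) 1 0 := by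
    have h1 : HasDerivAt (fun u => X (-u)) (1 / 2 * (-1)) 0 := by
      refine HasDerivAt.comp (0 : ℂ) (h₂ := X) (h := fun u => -u) ?_ (hasDerivAt_neg 0)
      simpa using h.dX0
    exact (h.dX0.sub h1).congr_deriv (by norm_num)
  have hev : ∀ᶠ z in 𝓝[≠] (0 : ℂ), X z - X (-z) ≠ 0 := hd.eventually_ne one_ne_zero
  have hev2 : ∀ᶠ z in 𝓝[≠] (0 : ℂ), X z + X (-z) + 2 * X z * X (-z) = 0 := by
    filter_upwards [hev, mem_nhdsWithin_of_mem_nhds (isOpen_ball.mem_nhds h.zero_mem)] with z hz hzb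
    have h1 := h.e2 z hzb
    have h2 := h.e2 (-z) (neg_mem' hzb)
    rw [neg_sq] at h2
    have h3 : (a * (X z - X (-z))) * (X z + X (-z) + 2 * X z * X (-z)) = 0 := by
      linear_combination (1 + 2 * X (-z)) * h1 - (1 + 2 * X z) * h2
    exact (mul_eq_zero.1 h3).resolve_left (mul_ne_zero h.ha hz)
  exact hA.eqOn_zero_of_preconnected_of_frequently_eq_zero (convex_ball _ _).isPreconnected
    h.zero_mem hev2.frequently hu

lemma injY_aux (h : BPair a r X Y) (n : ℕ) : ∀ {u v : ℂ}, u ∈ ball (0 : ℂ) r →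
    v ∈ ball (0 : ℂ) r → (∀ x : ℂ, ‖x‖ ≤ ‖u‖ ^ 2 → Y x ≠ -a) →
    u ^ (2 ^ n) = v ^ (2 ^ n) → X u = X v → u = v := by
  induction n with
  | zero => intro u v _ _ _ he _; simpa using he
  | succ n ih =>
    intro u v hu hv hna he hX
    have hu1 := h.lt_one hu
    have h1 : Y (u ^ 2) = Y (v ^ 2) := by
      have h2 := h.e2 u hu
      have h3 := h.e2 v hv
      rw [← hX] at h3
      have h4 : (Y (u ^ 2) - Y (v ^ 2)) * (1 + 2 * X u) = 0 := by linear_combination h3 - h2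
      exact sub_eq_zero.1 ((mul_eq_zero.1 h4).resolve_right (h.one_add_ne hu))
    have h2 : X (u ^ 2) = X (v ^ 2) := by
      have h3 := h.e1 _ (h.sq_mem hu)
      have h4 := h.e1 _ (h.sq_mem hv)
      rw [h1] at h3
      exact mul_left_cancel₀ h.ha (h3.symm.trans h4)
    have h3 : u ^ 2 = v ^ 2 := by
      refine ih (h.sq_mem hu) (h.sq_mem hv) (fun x hx => hna x (hx.trans ?_)) ?_ h2
      · rw [norm_pow]
        have : ‖u‖ ^ 2 ≤ 1 := pow_le_one₀ (norm_nonneg _) hu1.le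
        nlinarith [sq_nonneg ‖u‖]
      · rw [← pow_mul, ← pow_mul, ← pow_succ']
        exact he
    rcases sq_eq_sq_iff_eq_or_eq_neg.1 h3 with h4 | h4
    · exact h4
    · by_cases hu0 : u = 0
      · rw [hu0] at h4 ⊢
        have h5 : v = 0 := by simpa using h4
        exact h5.symm
      exfalso
      have h5 : v = -u := by rw [h4, neg_neg]
      have h6 := h.sum_eq hu
      rw [← h5, ← hX] at h6
      have h7 := h.X_ne_zero hu hu0
      have h8 : X u * (1 + X u) = 0 := by linear_combination (1 / 2) * h6
      have h9 : X u = -1 := by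
        have := (mul_eq_zero.1 h8).resolve_left h7
        linear_combination this
      have h10 := h.e2 u hu
      rw [h9] at h10
      refine hna (u ^ 2) (by rw [norm_pow]) ?_
      linear_combination h10

lemma exists_loc_inj (h : BPair a r X Y) : ∃ ρ > 0, Set.InjOn X (ball 0 ρ) := by
  have hs : HasStrictDerivAt X (1 / 2) 0 := by
    have h1 : AnalyticAt ℂ X 0 := h.dX.analyticAt (isOpen_ball.mem_nhds h.zero_mem)
    have h2 := h1.hasStrictDerivAt
    rwa [h.dX0.deriv] at h2
  have h3 := hs.hasStrictFDerivAt_equiv (by norm_num)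
  have h4 := (h3.toOpenPartialHomeomorph X).open_source.mem_nhds
    (h3.mem_toOpenPartialHomeomorph_source)
  obtain ⟨ρ, hρ, hb⟩ := Metric.mem_nhds_iff.1 h4
  exact ⟨ρ, hρ, (h3.toOpenPartialHomeomorph X).injOn.mono hb⟩

lemma injX (h : BPair a r X Y) {u v : ℂ} (hu : u ∈ ball (0 : ℂ) r)
    (hv : v ∈ ball (0 : ℂ) r) (hna : ∀ x : ℂ, ‖x‖ ≤ ‖u‖ ^ 2 → Y x ≠ -a)
    (hX : X u = X v) : u = v := by
  obtain ⟨ρ, hρ, hinj⟩ := h.exists_loc_inj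
  have hall : ∀ n : ℕ, X (u ^ (2 ^ n)) = X (v ^ (2 ^ n)) := by
    intro n
    induction n with
    | zero => simpa using hX
    | succ n ih =>
      rw [pow_succ 2 n, pow_mul, pow_mul]
      have h2 := h.e2 _ (h.pow_mem hu n)
      have h3 := h.e2 _ (h.pow_mem hv n)
      rw [← ih] at h3
      have h4 : (Y ((u ^ 2 ^ n) ^ 2) - Y ((v ^ 2 ^ n) ^ 2)) * (1 + 2 * X (u ^ 2 ^ n)) = 0 := by
        linear_combination h3 - h2
      have h5 := sub_eq_zero.1 ((mul_eq_zero.1 h4).resolve_right (h.one_add_ne (h.pow_mem hu n)))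
      have h6 := h.e1 _ (h.sq_mem (h.pow_mem hu n))
      have h7 := h.e1 _ (h.sq_mem (h.pow_mem hv n))
      rw [h5] at h6
      exact mul_left_cancel₀ h.ha (h6.symm.trans h7)
  have h1 := (tendsto_pow_two_pow (h.lt_one hu)).eventually (ball_mem_nhds 0 hρ)
  have h2 := (tendsto_pow_two_pow (h.lt_one hv)).eventually (ball_mem_nhds 0 hρ)
  obtain ⟨n, hn1, hn2⟩ := (h1.and h2).exists
  exact h.injY_aux n hu hv hna (hinj hn1 hn2 (hall n)) hX

lemma injY (h : BPair a r X Y) {u v : ℂ} (hu : u ∈ ball (0 : ℂ) r)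
    (hv : v ∈ ball (0 : ℂ) r) (hna : ∀ x : ℂ, ‖x‖ ≤ ‖u‖ ^ 2 → Y x ≠ -a)
    (hY : Y u = Y v) : u = v := by
  refine h.injX hu hv hna ?_
  have h6 := h.e1 _ hu
  have h7 := h.e1 _ hv
  rw [hY] at h6
  exact mul_left_cancel₀ h.ha (h6.symm.trans h7)

lemma half_mem (h : BPair a r X Y) : ((r / 2 : ℝ) : ℂ) ∈ ball (0 : ℂ) r := by
  have := h.r_pos
  rw [mem_ball_zero_iff, Complex.norm_real, Real.norm_of_nonneg (by positivity)]
  linarith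

lemma half_ne (h : BPair a r X Y) : ((r / 2 : ℝ) : ℂ) ≠ 0 := by
  have := h.r_pos
  exact_mod_cast (by positivity : (r / 2 : ℝ) ≠ 0)

lemma openX (h : BPair a r X Y) {s : Set ℂ} (hs : s ⊆ ball 0 r) (hso : IsOpen s) :
    IsOpen (X '' s) := by
  rcases (h.dX.analyticOnNhd isOpen_ball).is_constant_or_isOpen
    (convex_ball _ _).isPreconnected with ⟨w, hw⟩ | hop
  · exfalso
    have h1 := hw 0 h.zero_mem
    have h2 := hw _ h.half_mem
    rw [h.X0] at h1
    rw [← h1] at h2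
    exact h.X_ne_zero h.half_mem h.half_ne h2
  · exact hop s hs hso

lemma openY (h : BPair a r X Y) {s : Set ℂ} (hs : s ⊆ ball 0 r) (hso : IsOpen s) :
    IsOpen (Y '' s) := by
  rcases (h.dY.analyticOnNhd isOpen_ball).is_constant_or_isOpen
    (convex_ball _ _).isPreconnected with ⟨w, hw⟩ | hop
  · exfalso
    have h1 := hw 0 h.zero_mem
    have h2 := hw _ h.half_mem
    rw [h.Y0] at h1
    rw [← h1] at h2
    exact h.Y_ne_zero h.half_mem h.half_ne h2
  · exact hop s hs hso

end BPair

lemma exists_sqrt_ratio {S Q : Set ℂ} (hS : IsOpen S) (hSc : IsPreconnected S)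
    (hd : Disjoint Q S) {c c' : ℂ} (hc : c ∈ S) (hc' : c' ∈ S) :
    ∃ H : ℂ → ℂ, DifferentiableOn ℂ H Q ∧ ∀ y ∈ Q, H y ^ 2 * (y - c') = y - c := by
  have hne : ∀ y ∈ Q, ∀ c ∈ S, y - c ≠ 0 := by
    intro y hy c hc h
    rw [sub_eq_zero] at h
    exact Set.disjoint_left.1 hd hy (h ▸ hc)
  refine hSc.induction₂ (fun c c' => ∃ H : ℂ → ℂ, DifferentiableOn ℂ H Q ∧
    ∀ y ∈ Q, H y ^ 2 * (y - c') = y - c) ?_ ?_ ?_ hc hc'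
  · intro x hx
    obtain ⟨d, hd0, hdS⟩ := Metric.isOpen_iff.1 hS x hx
    filter_upwards [mem_nhdsWithin_of_mem_nhds (ball_mem_nhds x hd0), self_mem_nhdsWithin]
      with y hy hyS
    have hsl : ∀ z ∈ Q, 1 + -((y - x) / (z - x)) ∈ Complex.slitPlane := by
      intro z hz
      apply Complex.mem_slitPlane_of_norm_lt_one
      have h1 : d ≤ ‖z - x‖ := by
        by_contra h
        push Not at h
        exact Set.disjoint_left.1 hd hz (hdS (by rwa [mem_ball, dist_eq_norm]))
      rw [norm_neg, norm_div, div_lt_one (by linarith)]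
      rw [mem_ball, dist_eq_norm] at hy
      linarith
    refine ⟨fun z => Complex.exp (-(1 / 2) * Complex.log (1 + -((y - x) / (z - x)))), ?_, ?_⟩
    · intro z hz
      have h1 := hne z hz x hx
      have h2 : DifferentiableAt ℂ (fun z => 1 + -((y - x) / (z - x))) z := by
        refine DifferentiableAt.add (by fun_prop) (DifferentiableAt.neg ?_)
        exact DifferentiableAt.div (by fun_prop) (by fun_prop) h1
      exact ((h2.clog (hsl z hz)).const_mul _).cexp.differentiableWithinAt
    · intro z hz
      have h1 := hne z hz x hx
      have h2 := hne z hz y hyS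
      have h4 := Complex.slitPlane_ne_zero (hsl z hz)
      have h3 : (Complex.exp (-(1 / 2) * Complex.log (1 + -((y - x) / (z - x))))) ^ 2
          = (1 + -((y - x) / (z - x)))⁻¹ := by
        rw [← Complex.exp_nat_mul]
        conv_rhs => rw [← Complex.exp_log h4, ← Complex.exp_neg]
        congr 1
        push_cast
        ring
      rw [h3]
      have h5 : 1 + -((y - x) / (z - x)) = (z - y) / (z - x) := by
        field_simp
        ring
      rw [h5]
      field_simp
  · rintro x y z hx hy hz ⟨H, hH, hH'⟩ ⟨G, hG, hG'⟩
    refine ⟨fun w => H w * G w, hH.mul hG, fun w hw => ?_⟩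
    rw [← hH' w hw, ← hG' w hw]
    ring
  · rintro x y hx hy ⟨H, hH, hH'⟩
    have hH0 : ∀ w ∈ Q, H w ≠ 0 := by
      intro w hw h0
      have := hH' w hw
      rw [h0] at this
      exact hne w hw x hx (by rw [← this]; ring)
    refine ⟨fun w => (H w)⁻¹, hH.inv hH0, fun w hw => ?_⟩
    have h1 := hH0 w hw
    rw [← hH' w hw]
    field_simp

namespace BPair

variable {a : ℂ} {r : ℝ} {X Y : ℂ → ℂ}

lemma exists_min_attained (h : BPair a r X Y) {u₁ : ℂ} (hu₁ : u₁ ∈ ball (0 : ℂ) r)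
    (hY : Y u₁ = -a) : ∃ u₂ ∈ ball (0 : ℂ) r, Y u₂ = -a ∧ ∀ x : ℂ, ‖x‖ < ‖u₂‖ → Y x ≠ -a := by
  have hsub : closedBall (0 : ℂ) ‖u₁‖ ⊆ ball 0 r :=
    closedBall_subset_ball (by simpa using hu₁)
  have hc : IsCompact (closedBall (0 : ℂ) ‖u₁‖ ∩ Y ⁻¹' {-a}) := by
    refine (isCompact_closedBall _ _).of_isClosed_subset ?_ Set.inter_subset_left
    exact (h.dY.continuousOn.mono hsub).preimage_isClosed_of_isClosed isClosed_closedBall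
      isClosed_singleton
  obtain ⟨u₂, hu₂, hmin⟩ := hc.exists_isMinOn ⟨u₁, by simp, hY⟩ continuous_norm.continuousOn
  refine ⟨u₂, hsub hu₂.1, hu₂.2, fun x hx hxa => ?_⟩
  have h1 : ‖u₂‖ ≤ ‖u₁‖ := by simpa using hu₂.1
  have h2 : ‖u₂‖ ≤ ‖x‖ := hmin ⟨by simpa using hx.le.trans h1, hxa⟩
  linarith

theorem not_attained (h : BPair a r X Y) {u₁ : ℂ} (hu₁ : u₁ ∈ ball (0 : ℂ) r) : Y u₁ ≠ -a := by
  intro hY1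
  obtain ⟨u₂, hu₂, hY2, hmin⟩ := h.exists_min_attained hu₁ hY1
  set m := ‖u₂‖ with hm
  have hm0 : 0 < m := by
    rw [hm, norm_pos_iff]
    rintro rfl
    rw [h.Y0] at hY2
    exact h.ha (by linear_combination hY2)
  have hm1 : m < 1 := h.lt_one hu₂
  have hmr : m < r := by simpa using hu₂
  obtain ⟨t, hmt, htr, htm⟩ : ∃ t, m < t ∧ t < r ∧ t ^ 2 ≤ m := by
    refine ⟨min ((m + r) / 2) (√m), lt_min (by linarith) ?_, (min_le_left _ _).trans_lt
      (by linarith), ?_⟩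
    · rw [Real.lt_sqrt hm0.le]; nlinarith
    · have h1 : 0 ≤ min ((m + r) / 2) (√m) := le_min (by linarith) (Real.sqrt_nonneg _)
      calc _ ≤ (√m) ^ 2 := pow_le_pow_left₀ h1 (min_le_right _ _) 2
        _ = m := Real.sq_sqrt hm0.le
  obtain ⟨s, hms, hst⟩ := exists_between hmt
  have hs0 : 0 < s := hm0.trans hms
  have htsub : ball (0 : ℂ) t ⊆ ball 0 r := ball_subset_ball htr.le
  have hssub : ball (0 : ℂ) s ⊆ ball 0 r := ball_subset_ball (hst.trans htr).le
  have hcsub : closedBall (0 : ℂ) s ⊆ ball 0 r := closedBall_subset_ball (hst.trans htr)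
  have hinj : Set.InjOn Y (ball 0 t) := by
    intro u hu v hv huv
    refine h.injY (htsub hu) (htsub hv) (fun x hx => hmin x ?_) huv
    rw [mem_ball_zero_iff] at hu
    have : ‖u‖ ^ 2 < t ^ 2 := pow_lt_pow_left₀ hu (norm_nonneg _) (by norm_num)
    linarith
  set Q : Set ℂ := (Y '' closedBall 0 s)ᶜ with hQdef
  have hQc : IsPreconnected Q := isPreconnected_compl_image hs0.le hst (h.dY.mono htsub) hinj
    (h.openY htsub isOpen_ball)
  have hQo : IsOpen Q := (((isCompact_closedBall _ _).image_of_continuousOn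
    (h.dY.continuousOn.mono hcsub)).isClosed).isOpen_compl
  set S : Set ℂ := Y '' ball 0 s with hSdef
  have hSo : IsOpen S := h.openY hssub isOpen_ball
  have hSc : IsPreconnected S := ((convex_ball _ _).isPreconnected).image _
    (h.dY.continuousOn.mono hssub)
  have hdis : Disjoint Q S := by
    rw [Set.disjoint_left]
    rintro y hy ⟨u, hu, rfl⟩
    exact hy ⟨u, ball_subset_closedBall hu, rfl⟩
  have h0S : (0 : ℂ) ∈ S := ⟨0, mem_ball_self hs0, h.Y0⟩
  have haS : -a ∈ S := ⟨u₂, by simpa using hms, hY2⟩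
  have hQ0 : ∀ y ∈ Q, y ≠ 0 := fun y hy e => Set.disjoint_left.1 hdis hy (e ▸ h0S)
  have hQa : ∀ y ∈ Q, y ≠ -a := fun y hy e => Set.disjoint_left.1 hdis hy (e ▸ haS)
  have hXQ : ∀ u ∈ ball (0 : ℂ) r, u ≠ 0 → (X u)⁻¹ ∈ Q := by
    rintro u hu hu0 ⟨v, hv, hvu⟩
    refine h.not_meet hu (hcsub hv) ?_
    rw [hvu]
    exact mul_inv_cancel₀ (h.X_ne_zero hu hu0)
  have key : ∃ H : ℂ → ℂ, DifferentiableOn ℂ H Q ∧ (∀ y ∈ Q, H y ^ 2 * y = y + a) ∧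
      ∀ u ∈ ball (0 : ℂ) r, u ≠ 0 → H (X u)⁻¹ = Y u + 1 := by
    obtain ⟨H, hH, hH'⟩ := exists_sqrt_ratio hSo hSc hdis haS h0S
    have hH2 : ∀ y ∈ Q, H y ^ 2 * y = y + a := by
      intro y hy
      have := hH' y hy
      rw [sub_zero, sub_neg_eq_add] at this
      exact this
    have hH0 : ∀ y ∈ Q, H y ≠ 0 := by
      intro y hy e
      have := hH2 y hy
      rw [e] at this
      exact hQa y hy (by linear_combination -this)
    set P : Set ℂ := {u : ℂ | 0 < ‖u‖ ∧ ‖u‖ < r} with hP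
    have hPm : ∀ u ∈ P, u ∈ ball (0 : ℂ) r ∧ u ≠ 0 := by
      intro u hu
      exact ⟨by simpa using hu.2, norm_pos_iff.1 hu.1⟩
    have hc1 : ContinuousOn (fun u => Y u + 1) P :=
      ((h.dY.continuousOn).add continuousOn_const).mono (fun u hu => (hPm u hu).1)
    have hc2 : ContinuousOn (fun u => H (X u)⁻¹) P := by
      refine ContinuousOn.comp (t := Q) (f := fun u => (X u)⁻¹) hH.continuousOn ?_ (fun u hu => ?_)
      · exact (h.dX.continuousOn.mono (fun u hu => (hPm u hu).1)).inv₀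
          (fun u hu => h.X_ne_zero (hPm u hu).1 (hPm u hu).2)
      · exact hXQ u (hPm u hu).1 (hPm u hu).2
    have hsq : Set.EqOn ((fun u => Y u + 1) ^ 2) ((fun u => H (X u)⁻¹) ^ 2) P := by
      intro u hu
      obtain ⟨hu1, hu2⟩ := hPm u hu
      have h1 := hH2 _ (hXQ u hu1 hu2)
      have h2 := h.X_ne_zero hu1 hu2
      have h3 := h.e1 u hu1
      simp only [Pi.pow_apply]
      have h4 : H (X u)⁻¹ ^ 2 = 1 + a * X u := by
        have h5 : (X u)⁻¹ * X u = 1 := inv_mul_cancel₀ h2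
        linear_combination X u * h1 + (1 - H (X u)⁻¹ ^ 2) * h5
      rw [h4]
      linear_combination h3
    rcases (isPreconnected_annulus 0 r le_rfl).eq_or_eq_neg_of_sq_eq hc1 hc2 hsq
      (fun {u} hu => hH0 _ (hXQ u (hPm u hu).1 (hPm u hu).2)) with he | he
    · refine ⟨H, hH, hH2, fun u hu hu0 => (he ?_).symm⟩
      exact ⟨norm_pos_iff.2 hu0, by simpa using hu⟩
    · refine ⟨fun y => -H y, hH.neg, fun y hy => ?_, fun u hu hu0 => (he ?_).symm⟩
      · rw [neg_sq]; exact hH2 y hy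
      · exact ⟨norm_pos_iff.2 hu0, by simpa using hu⟩
  obtain ⟨H, hH, hH2, hHX⟩ := key
  have hH0 : ∀ y ∈ Q, H y ≠ 0 := by
    intro y hy e
    have := hH2 y hy
    rw [e] at this
    exact hQa y hy (by linear_combination -this)
  -- if `H x = ± (Y u + 1)` then `x = 1 / X u`
  have hinvX : ∀ x ∈ Q, ∀ u ∈ ball (0 : ℂ) r, H x ^ 2 = (Y u + 1) ^ 2 →
      u ≠ 0 ∧ X u * x = 1 := by
    intro x hx u hu he
    have h1 := hH2 x hx
    rw [he] at h1
    have h2 := h.e1 u hu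
    have h3 : a * (X u * x - 1) = 0 := by linear_combination h1 - x * h2
    have h4 := (mul_eq_zero.1 h3).resolve_left h.ha
    have h5 : X u * x = 1 := by linear_combination h4
    refine ⟨?_, h5⟩
    rintro rfl
    rw [h.X0] at h5
    simp at h5
  have hG : ∀ y ∈ Q, -1 - H y ∈ Q := by
    rintro y hy ⟨u, hu, hue⟩
    obtain ⟨hu0, hXu⟩ := hinvX y hy u (hcsub hu) (by rw [hue]; ring)
    have h1 := hHX u (hcsub hu) hu0
    rw [inv_eq_of_mul_eq_one_right hXu] at h1
    rw [hue] at h1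
    refine hH0 y hy ?_
    linear_combination (1 / 2) * h1
  have hf : ∀ y ∈ Q, -1 + H (-1 - H y) ∉ Y '' ball 0 t := by
    rintro y hy ⟨u, hu, hue⟩
    obtain ⟨hu0, hXu⟩ := hinvX _ (hG y hy) u (htsub hu) (by rw [hue]; ring)
    have h1 := h.e2 u (htsub hu)
    have h2 := hH2 y hy
    set x := -1 - H y with hx
    have h3 : H y = -1 - x := by rw [hx]; ring
    rw [h3] at h2
    have h4 : a = Y (u ^ 2) * (x ^ 2 + 2 * x) := by
      linear_combination x ^ 2 * h1 + (- a * (X u * x + 1) + 2 * Y (u^2) * x) * hXu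
    have h5 : (x ^ 2 + 2 * x) * (y - Y (u ^ 2)) = 0 := by
      linear_combination h2 + h4
    have h6 : x ^ 2 + 2 * x ≠ 0 := by
      intro e
      rw [e, mul_zero] at h4
      exact h.ha h4
    have h7 := (mul_eq_zero.1 h5).resolve_left h6
    refine hy ⟨u ^ 2, ?_, by linear_combination -h7⟩
    rw [mem_closedBall_zero_iff, norm_pow]
    rw [mem_ball_zero_iff] at hu
    have : ‖u‖ ^ 2 < t ^ 2 := pow_lt_pow_left₀ hu (norm_nonneg _) (by norm_num)
    linarith
  obtain ⟨d, hd0, hdS⟩ := Metric.isOpen_iff.1 hSo 0 h0S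
  have hHb : ∀ y ∈ Q, ‖H y‖ ≤ 1 + ‖a‖ / d := by
    intro y hy
    have h1 : d ≤ ‖y‖ := by
      by_contra hlt
      push Not at hlt
      exact Set.disjoint_left.1 hdis hy (hdS (by simpa using hlt))
    have h2 : H y ^ 2 = 1 + a / y := by
      have := hH2 y hy
      have := hQ0 y hy
      field_simp
      assumption
    have h3 : ‖H y‖ ^ 2 ≤ 1 + ‖a‖ / d := by
      rw [← norm_pow, h2]
      refine (norm_add_le _ _).trans ?_
      rw [norm_one, norm_div]
      gcongr
    have h4 : 0 ≤ ‖a‖ / d := by positivity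
    nlinarith [norm_nonneg (H y)]
  set M := 1 + (1 + ‖a‖ / d) with hM
  set K : Set ℂ := closedBall 0 M ∩ (Y '' ball 0 t)ᶜ with hK
  have hKc : IsCompact K := (isCompact_closedBall _ _).inter_right
    (h.openY htsub isOpen_ball).isClosed_compl
  have hKQ : K ⊆ Q := by
    rintro y ⟨-, hy⟩ ⟨u, hu, hue⟩
    exact hy ⟨u, closedBall_subset_ball hst hu, hue⟩
  have hmaps : Set.MapsTo (fun y => -1 + H (-1 - H y)) Q K := by
    intro y hy
    refine ⟨?_, hf y hy⟩
    rw [mem_closedBall_zero_iff]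
    refine (norm_add_le _ _).trans ?_
    rw [norm_neg, norm_one]
    have := hHb _ (hG y hy)
    linarith
  have hdiff : DifferentiableOn ℂ (fun y => -1 + H (-1 - H y)) Q := by
    have h1 : DifferentiableOn ℂ (fun y => -1 - H y) Q := hH.const_sub _
    exact (hH.comp h1 hG).const_add _
  obtain ⟨p, hp, hpe⟩ := earle_hamilton hQo hQc
    ⟨_, hXQ _ h.half_mem h.half_ne⟩ hdiff hmaps hKQ hKc
  have hx := hG p hp
  set x := -1 - H p with hxdef
  have h1 := hH2 p hp
  have h2 := hH2 x hx
  have h3 : H p = -1 - x := by rw [hxdef]; ring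
  have h4 : H x = p + 1 := by linear_combination hpe
  rw [h3] at h1
  rw [h4] at h2
  have h5 : p * x * (p - x) = 0 := by linear_combination h2 - h1
  have h6 : p = x := by
    have := (mul_eq_zero.1 h5).resolve_left (mul_ne_zero (hQ0 p hp) (hQ0 x hx))
    linear_combination this
  refine hH0 p hp ?_
  rw [← h6] at h4 h3
  linear_combination (1 / 2) * h4 + (1 / 2) * h3

lemma injOnX (h : BPair a r X Y) : Set.InjOn X (ball 0 r) := by
  intro u hu v hv e
  refine h.injX hu hv (fun x hx => h.not_attained ?_) e
  have := h.sq_mem hu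
  rw [mem_ball_zero_iff, norm_pow] at this
  rw [mem_ball_zero_iff]
  linarith

lemma injOnY (h : BPair a r X Y) : Set.InjOn Y (ball 0 r) := by
  intro u hu v hv e
  refine h.injY hu hv (fun x hx => h.not_attained ?_) e
  have := h.sq_mem hu
  rw [mem_ball_zero_iff, norm_pow] at this
  rw [mem_ball_zero_iff]
  linarith

end BPair

/-- Inversion `v ↦ 1/v` from the plane to the sphere. -/
noncomputable def sinv (v : ℂ) : RSphere := if v = 0 then ∞ else ((v⁻¹ : ℂ) : RSphere)

/-- Inversion as a self-map of the sphere. -/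
noncomputable def sinvS : RSphere → RSphere := fun z =>
  match z with
  | ∞ => ((0 : ℂ) : RSphere)
  | (w : ℂ) => sinv w

lemma sinv_zero : sinv 0 = ∞ := by simp [sinv]

lemma sinv_of_ne {v : ℂ} (hv : v ≠ 0) : sinv v = ((v⁻¹ : ℂ) : RSphere) := by simp [sinv, hv]

lemma tendsto_coe_cobounded : Tendsto (fun z : ℂ => (z : RSphere)) (Bornology.cobounded ℂ) (𝓝 ∞) := by
  have := OnePoint.tendsto_coe_infty (X := ℂ)
  rwa [Filter.coclosedCompact_eq_cocompact, ← Metric.cobounded_eq_cocompact] at this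

lemma continuousAt_infty_iff {f : RSphere → RSphere} :
    ContinuousAt f ∞ ↔ Tendsto (fun z : ℂ => f z) (Bornology.cobounded ℂ) (𝓝 (f ∞)) := by
  rw [OnePoint.continuousAt_infty', Filter.coclosedCompact_eq_cocompact,
    ← Metric.cobounded_eq_cocompact]
  rfl

lemma continuous_sinv : Continuous sinv := by
  rw [continuous_iff_continuousAt]
  intro v
  by_cases hv : v = 0
  · subst hv
    rw [continuousAt_iff_punctured_nhds, sinv_zero]
    have h1 := tendsto_coe_cobounded.comp (Filter.tendsto_inv₀_nhdsNE_zero (α := ℂ))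
    refine h1.congr' ?_
    filter_upwards [self_mem_nhdsWithin] with w hw
    exact (sinv_of_ne hw).symm
  · have h1 : ContinuousAt (fun w : ℂ => ((w⁻¹ : ℂ) : RSphere)) v :=
      OnePoint.continuous_coe.continuousAt.comp (continuousAt_inv₀ hv)
    refine h1.congr ?_
    filter_upwards [isOpen_ne.mem_nhds hv] with w hw
    exact (sinv_of_ne hw).symm

lemma continuous_sinvS : Continuous sinvS := by
  rw [continuous_iff_continuousAt]
  intro z
  induction z with
  | infty =>
    rw [continuousAt_infty_iff]
    have h1 : Tendsto (fun z : ℂ => ((z⁻¹ : ℂ) : RSphere)) (Bornology.cobounded ℂ)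
        (𝓝 ((0 : ℂ) : RSphere)) :=
      (OnePoint.continuous_coe.tendsto _).comp Filter.tendsto_inv₀_cobounded
    refine h1.congr' ?_
    filter_upwards [Bornology.eventually_ne_cobounded (0 : ℂ)] with w hw
    exact (sinv_of_ne hw).symm
  | coe z =>
    rw [OnePoint.continuousAt_coe]
    exact continuous_sinv.continuousAt

lemma sinvS_sinv (v : ℂ) : sinvS (sinv v) = v := by
  by_cases hv : v = 0
  · rw [hv, sinv_zero]; rfl
  · rw [sinv_of_ne hv]
    change sinv v⁻¹ = v
    rw [sinv_of_ne (inv_ne_zero hv), inv_inv]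

lemma sinv_injective : Function.Injective sinv := by
  intro v w h
  have := congrArg sinvS h
  rw [sinvS_sinv, sinvS_sinv] at this
  exact OnePoint.coe_injective this

lemma sinv_sinvS_coe (z : RSphere) (v : ℂ) (h : sinvS z = v) : z = sinv v := by
  induction z with
  | infty =>
    have : ((0 : ℂ) : RSphere) = v := h
    rw [← OnePoint.coe_injective this, sinv_zero]
  | coe z =>
    change sinv z = v at h
    by_cases hz : z = 0
    · rw [hz, sinv_zero] at h
      exact absurd h (OnePoint.infty_ne_coe v)
    · rw [sinv_of_ne hz] at h
      rw [← OnePoint.coe_injective h, sinv_of_ne (inv_ne_zero hz), inv_inv]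

lemma isOpen_sinv_image {T : Set ℂ} (hT : IsOpen T) : IsOpen (sinv '' T) := by
  have : sinv '' T = sinvS ⁻¹' ((fun z : ℂ => (z : RSphere)) '' T) := by
    ext z
    constructor
    · rintro ⟨v, hv, rfl⟩
      exact ⟨v, hv, (sinvS_sinv v).symm⟩
    · rintro ⟨v, hv, h⟩
      exact ⟨v, hv, (sinv_sinvS_coe z v h.symm).symm⟩
  rw [this]
  exact (OnePoint.isOpenMap_coe T hT).preimage continuous_sinvS

lemma sinv_eq_coe_iff {v z : ℂ} : sinv v = (z : RSphere) ↔ v * z = 1 := by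
  constructor
  · intro h
    by_cases hv : v = 0
    · rw [hv, sinv_zero] at h
      exact absurd h (OnePoint.infty_ne_coe z)
    · rw [sinv_of_ne hv] at h
      rw [← OnePoint.coe_injective h, mul_inv_cancel₀ hv]
  · intro h
    have hv : v ≠ 0 := left_ne_zero_of_mul_eq_one h
    rw [sinv_of_ne hv, inv_eq_of_mul_eq_one_right h]

lemma Rhat_coe_eq {a : ℂ} (ha : a ≠ 0) (w : ℂ) : Rhat a w = sinv ((w ^ 2 + 2 * w) / a) := by
  change (if w ^ 2 + 2 * w = 0 then ∞ else ((a / (w ^ 2 + 2 * w) : ℂ) : RSphere)) = _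
  by_cases h : w ^ 2 + 2 * w = 0
  · rw [if_pos h, h, zero_div, sinv_zero]
  · rw [if_neg h, sinv_of_ne (div_ne_zero h ha), inv_div]

lemma Rhat_infty (a : ℂ) : Rhat a ∞ = ((0 : ℂ) : RSphere) := rfl

lemma Rhat_coe_of {a x y : ℂ} (ha : a ≠ 0) (h : y ^ 2 + 2 * y = a * x) : Rhat a y = sinv x := by
  rw [Rhat_coe_eq ha, h, mul_div_cancel_left₀ _ ha]

lemma Rhat_sinv_of {a x y : ℂ} (ha : a ≠ 0) (_hx : 1 + 2 * x ≠ 0)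
    (h : a * x ^ 2 = y * (1 + 2 * x)) : Rhat a (sinv x) = y := by
  by_cases h0 : x = 0
  · rw [h0] at h ⊢
    rw [sinv_zero, Rhat_infty]
    congr 1
    linear_combination h
  · rw [sinv_of_ne h0, Rhat_coe_eq ha, sinv_eq_coe_iff]
    field_simp
    linear_combination -h

lemma continuous_Rhat {a : ℂ} (ha : a ≠ 0) : Continuous (Rhat a) := by
  rw [continuous_iff_continuousAt]
  intro z
  induction z with
  | infty =>
    rw [continuousAt_infty_iff, Rhat_infty]
    have h0 : Tendsto (fun z : ℂ => (a * (z⁻¹ * (z + 2)⁻¹))) (Bornology.cobounded ℂ)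
        (𝓝 (a * (0 * 0))) := by
      refine Tendsto.const_mul _ (Filter.tendsto_inv₀_cobounded.mul ?_)
      exact Filter.tendsto_inv₀_cobounded.comp (tendsto_add_const_cobounded 2)
    rw [mul_zero, mul_zero] at h0
    have h1 := (OnePoint.continuous_coe.tendsto (0 : ℂ)).comp h0
    refine h1.congr' ?_
    filter_upwards [Bornology.eventually_ne_cobounded (0 : ℂ), Bornology.eventually_ne_cobounded (-2 : ℂ)] with w hw hw2
    have hw3 : w + 2 ≠ 0 := fun e => hw2 (by linear_combination e)
    rw [Rhat_coe_eq ha]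
    symm
    rw [Function.comp_apply, sinv_eq_coe_iff]
    field_simp
  | coe z =>
    rw [OnePoint.continuousAt_coe]
    have : (Rhat a ∘ OnePoint.some) = fun w : ℂ => sinv ((w ^ 2 + 2 * w) / a) :=
      funext (fun w => Rhat_coe_eq ha w)
    rw [this]
    exact (continuous_sinv.comp (by fun_prop)).continuousAt

namespace BPair

variable {a : ℂ} {r : ℝ} {X Y : ℂ → ℂ}

lemma R_sinvX (h : BPair a r X Y) {u : ℂ} (hu : u ∈ ball (0 : ℂ) r) :
    Rhat a (sinv (X u)) = (Y (u ^ 2) : ℂ) :=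
  Rhat_sinv_of h.ha (h.one_add_ne hu) (h.e2 u hu)

lemma R_Y (h : BPair a r X Y) {u : ℂ} (hu : u ∈ ball (0 : ℂ) r) :
    Rhat a (Y u : ℂ) = sinv (X u) :=
  Rhat_coe_of h.ha (h.e1 u hu)

lemma R_iter (h : BPair a r X Y) {u : ℂ} (hu : u ∈ ball (0 : ℂ) r) (n : ℕ) :
    (Rhat a)^[2 * n] (sinv (X u)) = sinv (X (u ^ (2 ^ n))) := by
  induction n with
  | zero => simp
  | succ n ih =>
    rw [show 2 * (n + 1) = (2 * n + 1) + 1 by ring, Function.iterate_succ_apply',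
      Function.iterate_succ_apply', ih, h.R_sinvX (h.pow_mem hu n),
      h.R_Y (h.sq_mem (h.pow_mem hu n)), ← pow_mul, ← pow_succ]

lemma tends_iter (h : BPair a r X Y) {u : ℂ} (hu : u ∈ ball (0 : ℂ) r) :
    Tendsto (fun n => (Rhat a)^[2 * n] (sinv (X u))) atTop (𝓝 ∞) := by
  simp_rw [h.R_iter hu]
  rw [← sinv_zero]
  exact (continuous_sinv.tendsto 0).comp (h.tendsX hu)

lemma mem_basin (h : BPair a r X Y) {u : ℂ} (hu : u ∈ ball (0 : ℂ) r) :
    sinv (X u) ∈ sphereBasin a := Or.inl (h.tends_iter hu)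

end BPair

lemma mem_basin_of_iter {a : ℂ} {z : RSphere} (h : (Rhat a) (Rhat a z) ∈ sphereBasin a) :
    z ∈ sphereBasin a := by
  have key : ∀ n, (Rhat a)^[2 * (n + 1)] z = (Rhat a)^[2 * n] (Rhat a (Rhat a z)) := by
    intro n
    rw [show 2 * (n + 1) = (2 * n + 1) + 1 by ring, Function.iterate_succ_apply,
      Function.iterate_succ_apply]
  rcases h with h | h
  · left
    rw [← tendsto_add_atTop_iff_nat 1]
    simpa only [key] using h
  · right
    rw [← tendsto_add_atTop_iff_nat 1]
    simpa only [key] using h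

namespace BPair

variable {a : ℂ} {r : ℝ} {X Y : ℂ → ℂ}

lemma infty_mem (h : BPair a r X Y) : ∞ ∈ sphereBasin a := by
  have := h.mem_basin h.zero_mem
  rwa [h.X0, sinv_zero] at this

/-- A one-step extension of `X` still lands in `A_∞`. -/
lemma ext_mem_Ainf (h : BPair a r X Y) {X' : ℂ → ℂ} {r' : ℝ} (hr' : r' ^ 2 ≤ r) (hr0 : 0 < r')
    (hX' : ContinuousOn X' (ball 0 r')) (h0 : X' 0 = 0)
    (h1 : ∀ u ∈ ball (0 : ℂ) r', 1 + 2 * X' u ≠ 0)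
    (h2 : ∀ u ∈ ball (0 : ℂ) r', a * X' u ^ 2 = Y (u ^ 2) * (1 + 2 * X' u))
    {u : ℂ} (hu : u ∈ ball (0 : ℂ) r') : sinv (X' u) ∈ Ainf a := by
  have hpre : IsPreconnected ((fun u => sinv (X' u)) '' ball 0 r') :=
    (convex_ball _ _).isPreconnected.image _ (continuous_sinv.comp_continuousOn hX')
  refine hpre.subset_connectedComponentIn ?_ ?_ ⟨u, hu, rfl⟩
  · exact ⟨0, mem_ball_self hr0, by simp [h0, sinv_zero]⟩
  · rintro _ ⟨v, hv, rfl⟩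
    apply mem_basin_of_iter
    simp only
    have hv2 : v ^ 2 ∈ ball (0 : ℂ) r := by
      rw [mem_ball_zero_iff] at hv ⊢
      rw [norm_pow]
      have := pow_lt_pow_left₀ hv (norm_nonneg _) two_ne_zero
      linarith
    rw [Rhat_sinv_of h.ha (h1 v hv) (h2 v hv), h.R_Y hv2]
    exact h.mem_basin hv2

lemma sub_Ainf (h : BPair a r X Y) {u : ℂ} (hu : u ∈ ball (0 : ℂ) r) : sinv (X u) ∈ Ainf a :=
  h.ext_mem_Ainf (r' := r) (by nlinarith [h.r_pos, h.r_le]) h.r_pos h.dX.continuousOn h.X0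
    (fun _ hv => h.one_add_ne hv) h.e2 hu

lemma isOpen_V (h : BPair a r X Y) : IsOpen (sinv '' (X '' ball 0 r)) :=
  isOpen_sinv_image (h.openX subset_rfl isOpen_ball)

lemma Ainf_eq (h : BPair a 1 X Y) : Ainf a = sinv '' (X '' ball 0 1) := by
  apply Set.Subset.antisymm
  · refine isPreconnected_connectedComponentIn.subset_of_closure_inter_subset h.isOpen_V
      ⟨∞, mem_connectedComponentIn h.infty_mem, 0, ⟨0, h.zero_mem, h.X0⟩, sinv_zero⟩ ?_
    rintro z ⟨hzc, hz⟩
    have hzb : z ∈ sphereBasin a := connectedComponentIn_subset _ _ hz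
    have hsub : ball (0 : ℂ) (1 / 2) ⊆ ball 0 1 := ball_subset_ball (by norm_num)
    have hcont : ∀ n, Continuous (Rhat a)^[n] := fun n => (continuous_Rhat h.ha).iterate n
    rcases hzb with hzb | hzb
    · have hW : sinv '' (X '' ball 0 (1 / 2)) ∈ 𝓝 ∞ :=
        (isOpen_sinv_image (h.openX hsub isOpen_ball)).mem_nhds
          ⟨0, ⟨0, by simp, h.X0⟩, sinv_zero⟩
      obtain ⟨n, hn⟩ := (hzb.eventually_mem hW).exists
      have hN : (Rhat a)^[2 * n] ⁻¹' (sinv '' (X '' ball 0 (1 / 2))) ∈ 𝓝 z :=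
        ((isOpen_sinv_image (h.openX hsub isOpen_ball)).preimage (hcont _)).mem_nhds hn
      set C : Set ℂ := {u : ℂ | ‖u‖ ^ (2 ^ n) ≤ 1 / 2} with hC
      have hCsub : C ⊆ ball 0 1 := by
        intro u hu
        rw [mem_ball_zero_iff]
        by_contra hge
        push Not at hge
        have h1 : 1 ≤ ‖u‖ ^ (2 ^ n) := one_le_pow₀ hge
        have h2 : ‖u‖ ^ (2 ^ n) ≤ 1 / 2 := hu
        linarith
      have hCc : IsCompact C := by
        refine (isCompact_closedBall (0 : ℂ) 1).of_isClosed_subset ?_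
          (hCsub.trans ball_subset_closedBall)
        exact isClosed_le (by fun_prop) continuous_const
      have hcl : IsClosed ((fun u => sinv (X u)) '' C) :=
        (hCc.image_of_continuousOn
          (continuous_sinv.comp_continuousOn (h.dX.continuousOn.mono hCsub))).isClosed
      have hmem : z ∈ (fun u => sinv (X u)) '' C := by
        rw [← hcl.closure_eq, mem_closure_iff_nhds]
        intro t ht
        obtain ⟨y, ⟨hy1, hy2⟩, hy3⟩ := mem_closure_iff_nhds.1 hzc _ (inter_mem ht hN)
        obtain ⟨_, ⟨u, hu, rfl⟩, rfl⟩ := hy3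
        refine ⟨_, hy1, u, ?_, rfl⟩
        obtain ⟨_, ⟨v, hv, rfl⟩, hv2⟩ := hy2
        rw [h.R_iter hu] at hv2
        have h3 := h.injOnX (hsub hv) (h.pow_mem hu n) (sinv_injective hv2)
        rw [mem_ball_zero_iff, h3, norm_pow] at hv
        exact hv.le
      obtain ⟨u, hu, rfl⟩ := hmem
      exact ⟨X u, ⟨u, hCsub hu, rfl⟩, rfl⟩
    · exfalso
      have hWo : IsOpen ((fun z : ℂ => (z : RSphere)) '' (Y '' ball 0 1)) :=
        OnePoint.isOpenMap_coe _ (h.openY subset_rfl isOpen_ball)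
      obtain ⟨n, hn⟩ := (hzb.eventually_mem (hWo.mem_nhds
        ⟨0, ⟨0, h.zero_mem, h.Y0⟩, rfl⟩)).exists
      have hN := (hWo.preimage (hcont (2 * n))).mem_nhds hn
      obtain ⟨y, hy2, hy3⟩ := mem_closure_iff_nhds.1 hzc _ hN
      obtain ⟨_, ⟨u, hu, rfl⟩, rfl⟩ := hy3
      obtain ⟨_, ⟨v, hv, rfl⟩, hv2⟩ := hy2
      rw [h.R_iter hu] at hv2
      exact h.not_meet (h.pow_mem hu n) hv (sinv_eq_coe_iff.1 hv2.symm)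
  · rintro _ ⟨_, ⟨u, hu, rfl⟩, rfl⟩
    exact h.sub_Ainf hu

lemma coe_mem_Ainf_iff (h : BPair a 1 X Y) {z : ℂ} :
    (z : RSphere) ∈ Ainf a ↔ z ≠ 0 ∧ z⁻¹ ∈ X '' ball 0 1 := by
  rw [h.Ainf_eq]
  constructor
  · rintro ⟨x, hx, hxz⟩
    rw [sinv_eq_coe_iff] at hxz
    refine ⟨right_ne_zero_of_mul_eq_one hxz, ?_⟩
    rwa [inv_eq_of_mul_eq_one_left hxz]
  · rintro ⟨hz, hx⟩
    exact ⟨_, hx, sinv_eq_coe_iff.2 (inv_mul_cancel₀ hz)⟩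

end BPair

namespace BPair

variable {a : ℂ} {r : ℝ} {X Y : ℂ → ℂ}

theorem extend (h : BPair a r X Y) (haP : a ∉ Pinf) :
    ∃ X' Y' : ℂ → ℂ, BPair a (√r) X' Y' ∧ Set.EqOn X' X (ball 0 r) ∧
      Set.EqOn Y' Y (ball 0 r) := by
  have hr0 := h.r_pos
  have hr1 := h.r_le
  set r' := √r with hr'
  have hr'0 : 0 < r' := Real.sqrt_pos.2 hr0
  have hr'sq : r' ^ 2 = r := Real.sq_sqrt hr0.le
  have hr'1 : r' ≤ 1 := Real.sqrt_le_one.2 hr1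
  have hrr' : r ≤ r' := by nlinarith
  have hsub : ball (0 : ℂ) r ⊆ ball 0 r' := ball_subset_ball hrr'
  have hsq : ∀ u ∈ ball (0 : ℂ) r', u ^ 2 ∈ ball (0 : ℂ) r := by
    intro u hu
    rw [mem_ball_zero_iff] at hu ⊢
    rw [norm_pow, ← hr'sq]
    exact pow_lt_pow_left₀ hu (norm_nonneg _) two_ne_zero
  have hpre : IsPreconnected (ball (0 : ℂ) r) := (convex_ball _ _).isPreconnected
  have hn : ball (0 : ℂ) r ∈ 𝓝 0 := ball_mem_nhds _ hr0
  -- the function `k`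
  set k := dslope Y 0 with hk
  have hkd : DifferentiableOn ℂ k (ball 0 r) := (Complex.differentiableOn_dslope hn).2 h.dY
  have hk0 : k 0 = a / 4 := by rw [hk, dslope_same, h.dY0.deriv]
  have hkY : ∀ u, Y u = u * k u := by
    intro u
    have := sub_smul_dslope Y 0 u
    rw [h.Y0, sub_zero, sub_zero, smul_eq_mul] at this
    exact this.symm
  have hkne : ∀ u ∈ ball (0 : ℂ) r, k u ≠ 0 := by
    intro u hu hku
    by_cases hu0 : u = 0
    · rw [hu0, hk0] at hku
      exact h.ha (by linear_combination 4 * hku)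
    · refine h.Y_ne_zero hu hu0 ?_
      rw [hkY, hku, mul_zero]
  set κ := dslope X 0 with hκ
  have hκd : DifferentiableOn ℂ κ (ball 0 r) := (Complex.differentiableOn_dslope hn).2 h.dX
  have hκ0 : κ 0 = 1 / 2 := by rw [hκ, dslope_same, h.dX0.deriv]
  have hκX : ∀ u, X u = u * κ u := by
    intro u
    have := sub_smul_dslope X 0 u
    rw [h.X0, sub_zero, sub_zero, smul_eq_mul] at this
    exact this.symm
  have hκne : ∀ u ∈ ball (0 : ℂ) r, κ u ≠ 0 := by
    intro u hu hku
    by_cases hu0 : u = 0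
    · rw [hu0, hκ0] at hku
      norm_num at hku
    · refine h.X_ne_zero hu hu0 ?_
      rw [hκX, hku, mul_zero]
  -- the function `p` and its square root
  have hsqd : DifferentiableOn ℂ (fun u : ℂ => u ^ 2) (ball 0 r') := by fun_prop
  have hpd : DifferentiableOn ℂ (fun u => (Y (u ^ 2) + a) / k (u ^ 2)) (ball 0 r') :=
    ((h.dY.comp hsqd hsq).add_const _).div (hkd.comp hsqd hsq) (fun u hu => hkne _ (hsq u hu))
  have hpne : ∀ u ∈ ball (0 : ℂ) r', (Y (u ^ 2) + a) / k (u ^ 2) ≠ 0 := by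
    intro u hu
    refine div_ne_zero (fun e => ?_) (hkne _ (hsq u hu))
    exact h.not_attained (hsq u hu) (by linear_combination e)
  obtain ⟨q, hqd, hq2, hq0⟩ := exists_sqrt_ball hr'0 hpd hpne 2 (by
    have := h.ha
    rw [zero_pow two_ne_zero, h.Y0, hk0]
    field_simp
    ring)
  have hq2' : ∀ u ∈ ball (0 : ℂ) r', (q u - u) * (q u + u) * k (u ^ 2) = a := by
    intro u hu
    have h1 := hq2 u hu
    have h2 := hkne _ (hsq u hu)
    rw [eq_div_iff h2] at h1
    have h3 := hkY (u ^ 2)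
    linear_combination h1 + h3
  have hm : ∀ u ∈ ball (0 : ℂ) r', q u - u ≠ 0 := by
    intro u hu e
    have := hq2' u hu
    rw [e, zero_mul, zero_mul] at this
    exact h.ha this.symm
  have hp : ∀ u ∈ ball (0 : ℂ) r', q u + u ≠ 0 := by
    intro u hu e
    have := hq2' u hu
    rw [e, mul_zero, zero_mul] at this
    exact h.ha this.symm
  -- agreement of `q`
  have hqe : Set.EqOn q (fun u => (1 + X u) / κ u) (ball 0 r) := by
    have hpos : ∀ u ∈ ball (0 : ℂ) r, q u ≠ 0 := by
      intro u hu e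
      have h1 := hq2 u (hsub hu)
      rw [e] at h1
      exact hpne u (hsub hu) (by rw [← h1]; norm_num)
    refine Set.EqOn.symm (hpre.eq_of_sq_eq ?_ (hqd.continuousOn.mono hsub) ?_
      (fun {u} hu => hpos u hu) h.zero_mem ?_)
    · exact (continuousOn_const.add h.dX.continuousOn).div hκd.continuousOn hκne
    · intro u hu
      simp only [Pi.pow_apply]
      rw [hq2 u (hsub hu)]
      have h1 := hkne _ (h.sq_mem hu)
      have h2 := hκne u hu
      by_cases hu0 : u = 0
      · rw [hu0, h.X0, hκ0, zero_pow two_ne_zero, h.Y0, hk0]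
        have := h.ha
        field_simp
        ring
      · rw [div_pow, div_eq_div_iff (pow_ne_zero _ h2) h1]
        have h3 := h.e2 u hu
        have h4 := hkY (u ^ 2)
        have h5 := hκX u
        have h6 : u ^ 2 * ((1 + X u) ^ 2 * k (u ^ 2) - (Y (u ^ 2) + a) * κ u ^ 2) = 0 := by
          have : X u ^ 2 = u ^ 2 * κ u ^ 2 := by rw [h5]; ring
          linear_combination (-h3) - (1 + X u) ^ 2 * h4 + (Y (u ^ 2) + a) * this
        have h7 := (mul_eq_zero.1 h6).resolve_left (pow_ne_zero 2 hu0)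
        linear_combination h7
    · simp only [h.X0, hκ0, hq0]
      norm_num
  set X' : ℂ → ℂ := fun u => u / (q u - u) with hX'
  have hX'd : DifferentiableOn ℂ X' (ball 0 r') :=
    differentiableOn_id.div (hqd.sub differentiableOn_id) hm
  have hX'0 : X' 0 = 0 := by simp [hX']
  have hX'1 : ∀ u ∈ ball (0 : ℂ) r', 1 + 2 * X' u ≠ 0 := by
    intro u hu
    have h1 := hm u hu
    have : 1 + 2 * X' u = (q u + u) / (q u - u) := by
      simp only [hX']
      field_simp
      ring
    rw [this]
    exact div_ne_zero (hp u hu) h1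
  have hX'2 : ∀ u ∈ ball (0 : ℂ) r', a * X' u ^ 2 = Y (u ^ 2) * (1 + 2 * X' u) := by
    intro u hu
    have h1 := hm u hu
    have h2 := hq2' u hu
    rw [hkY]
    simp only [hX']
    rw [div_pow, ← mul_div_assoc, div_eq_iff (pow_ne_zero 2 h1)]
    have h3 : (1 + 2 * (u / (q u - u))) * (q u - u) ^ 2 = (q u + u) * (q u - u) := by
      field_simp
      ring
    linear_combination (-u ^ 2 * k (u ^ 2)) * h3 - u ^ 2 * h2
  have hXX : Set.EqOn X' X (ball 0 r) := by
    intro u hu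
    have h1 := hqe hu
    have h2 := hκne u hu
    have h3 := hκX u
    simp only [hX']
    rw [div_eq_iff (hm u (hsub hu)), h1]
    field_simp
    linear_combination (-1 - X u) * h3
  have hX'P : ∀ u ∈ ball (0 : ℂ) r', 1 + a * X' u ≠ 0 := by
    intro u hu e
    have h1 := h.ext_mem_Ainf hr'sq.le hr'0 hX'd.continuousOn hX'0 hX'1 hX'2 hu
    refine haP ⟨h.ha, ?_⟩
    rwa [sinv_eq_coe_iff.2 (show X' u * (-a) = 1 by linear_combination -e)] at h1
  obtain ⟨g, hgd, hg2, hg0⟩ := exists_sqrt_ball hr'0 ((hX'd.const_mul a).const_add 1) hX'P 1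
    (by rw [hX'0]; norm_num)
  have hYg : Set.EqOn g (fun u => Y u + 1) (ball 0 r) := by
    have hpos : ∀ u ∈ ball (0 : ℂ) r, g u ≠ 0 := by
      intro u hu e
      have h1 := hg2 u (hsub hu)
      rw [e] at h1
      exact hX'P u (hsub hu) (by rw [← h1]; norm_num)
    refine Set.EqOn.symm (hpre.eq_of_sq_eq ?_ (hgd.continuousOn.mono hsub) ?_
      (fun {u} hu => hpos u hu) h.zero_mem ?_)
    · exact h.dY.continuousOn.add continuousOn_const
    · intro u hu
      simp only [Pi.pow_apply]
      rw [hg2 u (hsub hu), hXX hu]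
      linear_combination h.e1 u hu
    · simp only [h.Y0, hg0, zero_add]
  have hYY : Set.EqOn (fun u => g u - 1) Y (ball 0 r) := by
    intro u hu
    simp only [hYg hu]
    ring
  refine ⟨X', fun u => g u - 1, ⟨hr'0, hr'1, h.ha, hX'd, hgd.sub_const _, hX'0, by simp [hg0],
    ?_, ?_, ?_⟩, hXX, hYY⟩
  · exact h.dX0.congr_of_eventuallyEq (hXX.eventuallyEq_of_mem hn)
  · intro u hu
    linear_combination hg2 u hu
  · intro u hu
    have h1 : g (u ^ 2) - 1 = Y (u ^ 2) := hYY (hsq u hu)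
    rw [h1]
    exact hX'2 u hu

end BPair

/-- The logarithm of the non-monomial part of the second iterate near infinity. -/
noncomputable def Glog (p : ℂ × ℂ) : ℂ :=
  Complex.log (1 + (2 * p.2 + p.1 * p.2 ^ 2 / 2)) - 2 * Complex.log (1 + 2 * p.2)

/-- Picard iterates for the Boettcher equation. -/
noncomputable def hseq : ℕ → ℂ × ℂ → ℂ
  | 0 => fun _ => 0
  | n + 1 => fun p => 1 / 2 * hseq n (p.1, p.2 ^ 2)
      - 1 / 2 * Glog (p.1, p.2 / 2 * Complex.exp (hseq n p))

/-- A small radius adapted to the parameter bound `A`. -/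
noncomputable def rhoA (A : ℝ) : ℝ := 1 / (512 * (1 + A))

/-- The domain of the Picard iterates. -/
def domA (A : ℝ) : Set (ℂ × ℂ) := {p | ‖p.1‖ < A ∧ ‖p.2‖ < rhoA A}

lemma Glog_args {A : ℝ} (hA : 0 < A) {p : ℂ × ℂ} (h1 : ‖p.1‖ < A) (h2 : ‖p.2‖ < 64 * rhoA A) :
    ‖2 * p.2 + p.1 * p.2 ^ 2 / 2‖ ≤ 1 / 2 ∧ ‖2 * p.2‖ ≤ 1 / 4 := by
  have h3 : (1 + A) * ‖p.2‖ < 1 / 8 := by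
    have : 64 * rhoA A = (1 / 8) / (1 + A) := by
      unfold rhoA
      field_simp
      norm_num
    rw [this, lt_div_iff₀ (by linarith)] at h2
    linarith
  have h4 := norm_nonneg p.2
  have h5 := norm_nonneg p.1
  have h6 : ‖p.2‖ < 1 / 8 := by nlinarith
  have h7 : ‖2 * p.2‖ ≤ 1 / 4 := by
    rw [norm_mul, Complex.norm_ofNat]
    linarith
  refine ⟨?_, h7⟩
  refine (norm_add_le _ _).trans ?_
  have h8 : ‖p.1 * p.2 ^ 2 / 2‖ ≤ 1 / 4 := by
    rw [norm_div, norm_mul, norm_pow, Complex.norm_ofNat]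
    have h9 : ‖p.1‖ * ‖p.2‖ ≤ 1 / 8 := by nlinarith
    nlinarith [mul_nonneg h5 h4]
  linarith

lemma Glog_slit {A : ℝ} (hA : 0 < A) {p : ℂ × ℂ} (h1 : ‖p.1‖ < A) (h2 : ‖p.2‖ < 64 * rhoA A) :
    1 + (2 * p.2 + p.1 * p.2 ^ 2 / 2) ∈ Complex.slitPlane ∧ 1 + 2 * p.2 ∈ Complex.slitPlane := by
  obtain ⟨h3, h4⟩ := Glog_args hA h1 h2
  exact ⟨Complex.mem_slitPlane_of_norm_lt_one (by linarith),
    Complex.mem_slitPlane_of_norm_lt_one (by linarith)⟩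

lemma Glog_diffAt {A : ℝ} (hA : 0 < A) {p : ℂ × ℂ} (h1 : ‖p.1‖ < A) (h2 : ‖p.2‖ < 64 * rhoA A) :
    DifferentiableAt ℂ Glog p := by
  obtain ⟨h3, h4⟩ := Glog_slit hA h1 h2
  unfold Glog
  refine DifferentiableAt.sub ?_ (DifferentiableAt.const_mul ?_ _)
  · exact DifferentiableAt.clog (by fun_prop) h3
  · exact DifferentiableAt.clog (by fun_prop) h4

lemma Glog_bound {A : ℝ} (hA : 0 < A) {p : ℂ × ℂ} (h1 : ‖p.1‖ < A) (h2 : ‖p.2‖ < 64 * rhoA A) :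
    ‖Glog p‖ ≤ 2 := by
  obtain ⟨h3, h4⟩ := Glog_args hA h1 h2
  have h5 := Complex.norm_log_one_add_half_le_self h3
  have h6 := Complex.norm_log_one_add_half_le_self (h4.trans (by norm_num))
  unfold Glog
  refine (norm_sub_le _ _).trans ?_
  rw [norm_mul, Complex.norm_ofNat]
  linarith

lemma Glog_zero (a : ℂ) : Glog (a, 0) = 0 := by simp [Glog]

lemma rhoA_pos {A : ℝ} (hA : 0 < A) : 0 < rhoA A := by unfold rhoA; positivity

lemma rhoA_small {A : ℝ} (hA : 0 < A) : rhoA A < 1 / 512 ∧ A * rhoA A < 1 / 512 := by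
  have h1 : (1 + A) * rhoA A = 1 / 512 := by unfold rhoA; field_simp
  have h2 := rhoA_pos hA
  constructor <;> nlinarith

lemma Glog_lip {A : ℝ} (hA : 0 < A) {a v w : ℂ} (ha : ‖a‖ < A) (hv : ‖v‖ < 16 * rhoA A)
    (hw : ‖w‖ < 16 * rhoA A) :
    ‖Glog (a, v) - Glog (a, w)‖ ≤ 4 / (32 * rhoA A) * ‖v - w‖ := by
  have hρ := rhoA_pos hA
  have hmem : ∀ z ∈ ball w (32 * rhoA A), ‖z‖ < 64 * rhoA A := by
    intro z hz
    rw [mem_ball, dist_eq_norm] at hz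
    calc ‖z‖ = ‖(z - w) + w‖ := by rw [sub_add_cancel]
      _ ≤ ‖z - w‖ + ‖w‖ := norm_add_le _ _
      _ < _ := by linarith
  have := Complex.dist_le_div_mul_dist_of_mapsTo_ball (f := fun z : ℂ => Glog (a, z))
    (c := w) (z := v) (R₁ := 32 * rhoA A) (R₂ := 4) ?_ ?_ ?_
  · simpa [dist_eq_norm] using this
  · intro z hz
    have h1 : DifferentiableAt ℂ Glog (a, z) := Glog_diffAt hA ha (hmem z hz)
    exact (h1.comp z (by fun_prop : DifferentiableAt ℂ (fun z : ℂ => (a, z)) z)).differentiableWithinAt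
  · intro z hz
    rw [mem_closedBall, dist_eq_norm]
    have h1 := Glog_bound hA (p := (a, z)) ha (hmem z hz)
    have h2 := Glog_bound hA (p := (a, w)) ha (by simpa using (by linarith : ‖w‖ < 64 * rhoA A))
    have h3 := norm_sub_le (Glog (a, z)) (Glog (a, w))
    linarith
  · rw [mem_ball, dist_eq_norm]
    have := norm_sub_le v w
    linarith

lemma domA_sq {A : ℝ} (hA : 0 < A) {p : ℂ × ℂ} (hp : p ∈ domA A) : (p.1, p.2 ^ 2) ∈ domA A := by
  refine ⟨hp.1, ?_⟩
  have h1 := hp.2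
  have h2 := (rhoA_small hA).1
  simp only [norm_pow]
  nlinarith [norm_nonneg p.2]

lemma exp_half_bound {x : ℂ} (hx : ‖x‖ ≤ 1 / 2) : ‖Complex.exp x‖ ≤ 2 := by
  have h1 := Complex.norm_exp_sub_one_le (hx.trans (by norm_num))
  calc ‖Complex.exp x‖ = ‖(Complex.exp x - 1) + 1‖ := by rw [sub_add_cancel]
    _ ≤ ‖Complex.exp x - 1‖ + ‖(1 : ℂ)‖ := norm_add_le _ _
    _ ≤ 2 := by rw [norm_one]; linarith

lemma half_exp_bound {u x : ℂ} (hx : ‖x‖ ≤ 1 / 2) : ‖u / 2 * Complex.exp x‖ ≤ ‖u‖ := by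
  rw [norm_mul, norm_div, Complex.norm_ofNat]
  nlinarith [exp_half_bound hx, norm_nonneg u]

lemma hseq_bound {A : ℝ} (hA : 0 < A) (n : ℕ) : ∀ p ∈ domA A, ‖hseq n p‖ ≤ 1 / 2 := by
  induction n with
  | zero => intro p _; simp [hseq]
  | succ n ih =>
    intro p hp
    have hρ := rhoA_pos hA
    have h1 := ih _ (domA_sq hA hp)
    have h2 := ih p hp
    have h3 : ‖p.2 / 2 * Complex.exp (hseq n p)‖ ≤ ‖p.2‖ := half_exp_bound h2
    have h4 := hp.2
    have h5 := Glog_lip hA hp.1 (v := p.2 / 2 * Complex.exp (hseq n p)) (w := 0) (by linarith)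
      (by simpa using hρ)
    rw [Glog_zero, sub_zero, sub_zero] at h5
    have h6 : 4 / (32 * rhoA A) * ‖p.2 / 2 * Complex.exp (hseq n p)‖ ≤ 1 / 8 := by
      rw [div_mul_eq_mul_div, div_le_iff₀ (by positivity)]
      linarith
    simp only [hseq]
    refine (norm_sub_le _ _).trans ?_
    rw [norm_mul, norm_mul]
    have h7 : ‖(1 / 2 : ℂ)‖ = 1 / 2 := by norm_num
    rw [h7]
    linarith

lemma hseq_diff {A : ℝ} (hA : 0 < A) (n : ℕ) : DifferentiableOn ℂ (hseq n) (domA A) := by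
  induction n with
  | zero => simp only [hseq]; exact differentiableOn_const _
  | succ n ih =>
    have hρ := rhoA_pos hA
    have h1 : DifferentiableOn ℂ (fun p : ℂ × ℂ => hseq n (p.1, p.2 ^ 2)) (domA A) :=
      ih.comp (f := fun p : ℂ × ℂ => (p.1, p.2 ^ 2)) (by fun_prop) (fun p hp => domA_sq hA hp)
    have h2 : DifferentiableOn ℂ (fun p : ℂ × ℂ => (p.1, p.2 / 2 * Complex.exp (hseq n p)))
        (domA A) := by
      refine DifferentiableOn.prodMk (by fun_prop) ?_
      exact DifferentiableOn.mul (by fun_prop) ih.cexp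
    have h3 : DifferentiableOn ℂ
        (fun p : ℂ × ℂ => Glog (p.1, p.2 / 2 * Complex.exp (hseq n p))) (domA A) := by
      intro p hp
      have h5 : ‖p.2 / 2 * Complex.exp (hseq n p)‖ ≤ ‖p.2‖ := half_exp_bound (hseq_bound hA n p hp)
      have h6 := hp.2
      have h4 : DifferentiableAt ℂ Glog (p.1, p.2 / 2 * Complex.exp (hseq n p)) :=
        Glog_diffAt hA hp.1 (by simp only; linarith)
      exact h4.comp_differentiableWithinAt (f := fun p : ℂ × ℂ =>
        (p.1, p.2 / 2 * Complex.exp (hseq n p))) p (h2 p hp)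
    simp only [hseq]
    exact (h1.const_mul _).sub (h3.const_mul _)

lemma hseq_step {A : ℝ} (hA : 0 < A) (n : ℕ) : ∀ p ∈ domA A,
    ‖hseq n p - hseq (n + 1) p‖ ≤ 1 / 2 * (3 / 4) ^ n := by
  induction n with
  | zero =>
    intro p hp
    have := hseq_bound hA 1 p hp
    simpa [hseq] using this
  | succ n ih =>
    intro p hp
    have hρ := rhoA_pos hA
    have h1 := ih _ (domA_sq hA hp)
    have h2 := ih p hp
    have h3 := hseq_bound hA n p hp
    have h4 := hseq_bound hA (n + 1) p hp
    have h5 := hp.2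
    have h6 := Glog_lip hA hp.1 (v := p.2 / 2 * Complex.exp (hseq n p))
      (w := p.2 / 2 * Complex.exp (hseq (n + 1) p))
      ((half_exp_bound h3).trans_lt (by linarith)) ((half_exp_bound h4).trans_lt (by linarith))
    set x := hseq n p with hx
    set y := hseq (n + 1) p with hy
    have h7 : ‖p.2 / 2 * Complex.exp x - p.2 / 2 * Complex.exp y‖ ≤ 2 * rhoA A * ‖x - y‖ := by
      have e1 : p.2 / 2 * Complex.exp x - p.2 / 2 * Complex.exp y
          = p.2 / 2 * Complex.exp y * (Complex.exp (x - y) - 1) := by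
        rw [Complex.exp_sub]
        have := Complex.exp_ne_zero y
        field_simp
      rw [e1, norm_mul]
      have e2 : ‖x - y‖ ≤ 1 := (norm_sub_le _ _).trans (by linarith)
      have e3 := Complex.norm_exp_sub_one_le e2
      have e4 := half_exp_bound (u := p.2) h4
      calc _ ≤ rhoA A * (2 * ‖x - y‖) := by gcongr; linarith
        _ = _ := by ring
    have h8 : 4 / (32 * rhoA A) * ‖p.2 / 2 * Complex.exp x - p.2 / 2 * Complex.exp y‖
        ≤ 1 / 4 * ‖x - y‖ := by
      rw [div_mul_eq_mul_div, div_le_iff₀ (by positivity)]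
      linarith
    have e : hseq (n + 1) p - hseq (n + 1 + 1) p
        = 1 / 2 * (hseq n (p.1, p.2 ^ 2) - hseq (n + 1) (p.1, p.2 ^ 2))
          - 1 / 2 * (Glog (p.1, p.2 / 2 * Complex.exp x) - Glog (p.1, p.2 / 2 * Complex.exp y)) := by
      rw [hx, hy]
      conv_lhs => simp only [hseq]
      simp only [hseq]
      ring
    rw [e]
    refine (norm_sub_le _ _).trans ?_
    rw [norm_mul, norm_mul]
    have h9 : ‖(1 / 2 : ℂ)‖ = 1 / 2 := by norm_num
    rw [h9, pow_succ (3 / 4 : ℝ)]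
    have h10 : 0 ≤ (3 / 4 : ℝ) ^ n := by positivity
    linarith

/-- The limit of the Picard iterates. -/
noncomputable def hlim (p : ℂ × ℂ) : ℂ := limUnder atTop (fun n => hseq n p)

lemma hseq_tendsto {A : ℝ} (hA : 0 < A) {p : ℂ × ℂ} (hp : p ∈ domA A) :
    Tendsto (fun n => hseq n p) atTop (𝓝 (hlim p)) := by
  refine (cauchySeq_of_le_geometric (3 / 4) (1 / 2) (by norm_num) (fun n => ?_)).tendsto_limUnder
  rw [dist_eq_norm]
  exact hseq_step hA n p hp

lemma hseq_unif {A : ℝ} (hA : 0 < A) : TendstoUniformlyOn hseq hlim atTop (domA A) := by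
  rw [Metric.tendstoUniformlyOn_iff]
  intro ε hε
  have h1 : Tendsto (fun n : ℕ => (1 / 2 : ℝ) * (3 / 4) ^ n / (1 - 3 / 4)) atTop (𝓝 0) := by
    have := (tendsto_pow_atTop_nhds_zero_of_lt_one (r := (3 / 4 : ℝ)) (by norm_num)
      (by norm_num)).const_mul (1 / 2)
    simpa using this.div_const (1 - 3 / 4)
  filter_upwards [h1.eventually_lt_const hε] with n hn p hp
  rw [dist_comm]
  refine lt_of_le_of_lt ?_ hn
  refine dist_le_of_le_geometric_of_tendsto (3 / 4) (1 / 2) (by norm_num) (fun n => ?_)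
    (hseq_tendsto hA hp) n
  rw [dist_eq_norm]
  exact hseq_step hA n p hp

lemma hlim_bound {A : ℝ} (hA : 0 < A) {p : ℂ × ℂ} (hp : p ∈ domA A) : ‖hlim p‖ ≤ 1 / 2 :=
  le_of_tendsto (hseq_tendsto hA hp).norm (Eventually.of_forall (fun n => hseq_bound hA n p hp))

lemma hlim_diff_a {A : ℝ} (hA : 0 < A) {u : ℂ} (hu : ‖u‖ < rhoA A) :
    DifferentiableOn ℂ (fun a => hlim (a, u)) (ball 0 A) := by
  have hm : ∀ a ∈ ball (0 : ℂ) A, (a, u) ∈ domA A := fun a ha => ⟨by simpa using ha, hu⟩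
  refine TendstoLocallyUniformlyOn.differentiableOn (F := fun n a => hseq n (a, u)) (φ := atTop)
    ?_ (Eventually.of_forall fun n => ?_) isOpen_ball
  · refine TendstoUniformlyOn.tendstoLocallyUniformlyOn ?_
    rw [Metric.tendstoUniformlyOn_iff]
    intro ε hε
    filter_upwards [Metric.tendstoUniformlyOn_iff.1 (hseq_unif hA) ε hε] with n hn a ha
    exact hn _ (hm a ha)
  · exact (hseq_diff hA n).comp (f := fun a : ℂ => (a, u)) (by fun_prop) hm

lemma hlim_diff_u {A : ℝ} (hA : 0 < A) {a : ℂ} (ha : ‖a‖ < A) :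
    DifferentiableOn ℂ (fun u => hlim (a, u)) (ball 0 (rhoA A)) := by
  have hm : ∀ u ∈ ball (0 : ℂ) (rhoA A), (a, u) ∈ domA A := fun u hu => ⟨ha, by simpa using hu⟩
  refine TendstoLocallyUniformlyOn.differentiableOn (F := fun n u => hseq n (a, u)) (φ := atTop)
    ?_ (Eventually.of_forall fun n => ?_) isOpen_ball
  · refine TendstoUniformlyOn.tendstoLocallyUniformlyOn ?_
    rw [Metric.tendstoUniformlyOn_iff]
    intro ε hε
    filter_upwards [Metric.tendstoUniformlyOn_iff.1 (hseq_unif hA) ε hε] with n hn u hu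
    exact hn _ (hm u hu)
  · exact (hseq_diff hA n).comp (f := fun u : ℂ => (a, u)) (by fun_prop) hm

lemma hlim_eq {A : ℝ} (hA : 0 < A) {a u : ℂ} (ha : ‖a‖ < A) (hu : ‖u‖ < rhoA A) :
    2 * hlim (a, u) = hlim (a, u ^ 2) - Glog (a, u / 2 * Complex.exp (hlim (a, u))) := by
  have hp : (a, u) ∈ domA A := ⟨ha, hu⟩
  have h1 := hseq_tendsto hA hp
  have h2 := hseq_tendsto hA (domA_sq hA hp)
  have h3 : ContinuousAt Glog (a, u / 2 * Complex.exp (hlim (a, u))) := by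
    refine (Glog_diffAt hA ha ?_).continuousAt
    have h4 := half_exp_bound (u := u) (hlim_bound hA hp)
    have h5 := rhoA_pos hA
    simp only
    linarith
  have h4 : Tendsto (fun n => (a, u / 2 * Complex.exp (hseq n (a, u)))) atTop
      (𝓝 (a, u / 2 * Complex.exp (hlim (a, u)))) := by
    refine Tendsto.prodMk_nhds tendsto_const_nhds (Tendsto.const_mul _ ?_)
    exact (Complex.continuous_exp.tendsto _).comp h1
  have h5 := h3.tendsto.comp h4
  have h6 : Tendsto (fun n => hseq (n + 1) (a, u)) atTop
      (𝓝 (1 / 2 * hlim (a, u ^ 2) - 1 / 2 * Glog (a, u / 2 * Complex.exp (hlim (a, u))))) := by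
    simp only [hseq]
    exact (h2.const_mul _).sub (h5.const_mul _)
  have h7 := tendsto_nhds_unique ((tendsto_add_atTop_iff_nat 1).2 h1) h6
  linear_combination 2 * h7

/-- The local solution `X`. -/
noncomputable def Xloc (a u : ℂ) : ℂ := u / 2 * Complex.exp (hlim (a, u))

/-- The local solution `Y`. -/
noncomputable def Yloc (a u : ℂ) : ℂ := Complex.exp (1 / 2 * Complex.log (1 + a * Xloc a u)) - 1

lemma Xloc_diff_a {A : ℝ} (hA : 0 < A) {u : ℂ} (hu : ‖u‖ < rhoA A) :
    DifferentiableOn ℂ (fun a => Xloc a u) (ball 0 A) :=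
  (hlim_diff_a hA hu).cexp.const_mul _

theorem bpair_loc {A : ℝ} (hA : 0 < A) {a : ℂ} (ha0 : a ≠ 0) (ha : ‖a‖ < A) :
    BPair a (rhoA A) (Xloc a) (Yloc a) := by
  have hρ := rhoA_pos hA
  obtain ⟨hs1, hs2⟩ := rhoA_small hA
  have hm : ∀ u ∈ ball (0 : ℂ) (rhoA A), (a, u) ∈ domA A := fun u hu => ⟨ha, by simpa using hu⟩
  have hXb : ∀ u ∈ ball (0 : ℂ) (rhoA A), ‖Xloc a u‖ ≤ ‖u‖ :=
    fun u hu => half_exp_bound (hlim_bound hA (hm u hu))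
  have hXb' : ∀ u ∈ ball (0 : ℂ) (rhoA A), ‖Xloc a u‖ < rhoA A :=
    fun u hu => (hXb u hu).trans_lt (by simpa using hu)
  have hd : DifferentiableOn ℂ (Xloc a) (ball 0 (rhoA A)) :=
    DifferentiableOn.mul (by fun_prop) (hlim_diff_u hA ha).cexp
  have hsl : ∀ u ∈ ball (0 : ℂ) (rhoA A), 1 + a * Xloc a u ∈ Complex.slitPlane := by
    intro u hu
    apply Complex.mem_slitPlane_of_norm_lt_one
    rw [norm_mul]
    have := hXb' u hu
    nlinarith [norm_nonneg a, norm_nonneg (Xloc a u)]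
  have hYd : DifferentiableOn ℂ (Yloc a) (ball 0 (rhoA A)) := by
    unfold Yloc
    exact ((((hd.const_mul a).const_add 1).clog hsl).const_mul _).cexp.sub_const _
  have hX0 : Xloc a 0 = 0 := by simp [Xloc]
  have hY0 : Yloc a 0 = 0 := by simp [Yloc, hX0]
  have h00 : hlim (a, 0) = 0 := by
    have := hlim_eq hA ha (u := 0) (by simpa using hρ)
    simp only [zero_div, zero_mul, Glog_zero, ne_eq, OfNat.ofNat_ne_zero, not_false_eq_true,
      zero_pow, sub_zero] at this
    linear_combination this
  have hsqY : ∀ u ∈ ball (0 : ℂ) (rhoA A), (Yloc a u + 1) ^ 2 = 1 + a * Xloc a u := by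
    intro u hu
    unfold Yloc
    rw [sub_add_cancel, ← Complex.exp_nat_mul]
    conv_rhs => rw [← Complex.exp_log (Complex.slitPlane_ne_zero (hsl u hu))]
    congr 1
    push_cast
    ring
  have hsq : ∀ u ∈ ball (0 : ℂ) (rhoA A), u ^ 2 ∈ ball (0 : ℂ) (rhoA A) := by
    intro u hu
    have := (domA_sq hA (hm u hu)).2
    simpa using this
  have h1X : ∀ u ∈ ball (0 : ℂ) (rhoA A), 1 + 2 * Xloc a u ≠ 0 := by
    intro u hu
    have h1 := hXb' u hu
    exact Complex.slitPlane_ne_zero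
      (Glog_slit hA (p := (a, Xloc a u)) ha (by simp only; linarith)).2
  have hF : ∀ u ∈ ball (0 : ℂ) (rhoA A), Xloc a (u ^ 2) * (1 + 2 * Xloc a u) ^ 2
      = Xloc a u ^ 2 * (2 + 4 * Xloc a u + a * Xloc a u ^ 2) := by
    intro u hu
    have h1 := hXb' u hu
    obtain ⟨s1, s2⟩ := Glog_slit hA (p := (a, Xloc a u)) ha (by simp only; linarith)
    have h2 := hlim_eq hA ha (u := u) (by simpa using hu)
    have h3 : Complex.exp (Glog (a, Xloc a u)) * (1 + 2 * Xloc a u) ^ 2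
        = 1 + (2 * Xloc a u + a * Xloc a u ^ 2 / 2) := by
      unfold Glog
      rw [Complex.exp_sub, Complex.exp_log (Complex.slitPlane_ne_zero s1)]
      have h4 : Complex.exp (2 * Complex.log (1 + 2 * Xloc a u)) = (1 + 2 * Xloc a u) ^ 2 := by
        have := Complex.exp_nat_mul (Complex.log (1 + 2 * Xloc a u)) 2
        rw [Complex.exp_log (Complex.slitPlane_ne_zero s2)] at this
        simpa using this
      simp only [h4]
      have := h1X u hu
      field_simp
    have h5 : Xloc a (u ^ 2) = 2 * Xloc a u ^ 2 * Complex.exp (Glog (a, Xloc a u)) := by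
      have h6 : hlim (a, u ^ 2) = 2 * hlim (a, u) + Glog (a, Xloc a u) := by
        unfold Xloc
        linear_combination -h2
      have h7 : Complex.exp (2 * hlim (a, u)) = Complex.exp (hlim (a, u)) ^ 2 := by
        have := Complex.exp_nat_mul (hlim (a, u)) 2
        simpa using this
      conv_lhs => rw [Xloc, h6, Complex.exp_add, h7]
      have h8 : Xloc a u ^ 2 = u ^ 2 / 4 * Complex.exp (hlim (a, u)) ^ 2 := by
        unfold Xloc
        ring
      rw [h8]
      ring
    rw [h5]
    linear_combination 2 * Xloc a u ^ 2 * h3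
  refine ⟨hρ, by linarith, ha0, hd, hYd, hX0, hY0, ?_, ?_, ?_⟩
  · have h1 : HasDerivAt (fun u : ℂ => hlim (a, u)) (deriv (fun u : ℂ => hlim (a, u)) 0) 0 :=
      ((hlim_diff_u hA ha).differentiableAt (ball_mem_nhds _ hρ)).hasDerivAt
    have h2 := ((hasDerivAt_id (0 : ℂ)).div_const 2).mul h1.cexp
    simp only [id, h00, Complex.exp_zero, zero_div, zero_mul, add_zero, mul_one] at h2
    exact h2
  · intro u hu
    linear_combination hsqY u hu
  · have hE : Set.EqOn (fun u => a * Xloc a u ^ 2 / (1 + 2 * Xloc a u) + 1)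
        (fun u => Yloc a (u ^ 2) + 1) (ball 0 (rhoA A)) := by
      refine (convex_ball (0 : ℂ) (rhoA A)).isPreconnected.eq_of_sq_eq ?_ ?_ ?_ ?_
        (mem_ball_self hρ) ?_
      · have hdc := hd.continuousOn
        refine ContinuousOn.add (ContinuousOn.div (by fun_prop) (by fun_prop) h1X)
          continuousOn_const
      · refine ContinuousOn.add (hYd.continuousOn.comp (by fun_prop) hsq) continuousOn_const
      · intro u hu
        simp only [Pi.pow_apply]
        rw [hsqY _ (hsq u hu)]
        have h1 := h1X u hu
        have h2 := hF u hu
        rw [div_add_one h1, div_pow, div_eq_iff (pow_ne_zero 2 h1)]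
        linear_combination (-a) * h2
      · intro u hu
        simp only [Yloc, sub_add_cancel]
        exact Complex.exp_ne_zero _
      · simp [hX0, hY0]
    intro u hu
    have h1 := hE hu
    have h2 := h1X u hu
    have h3 : a * Xloc a u ^ 2 / (1 + 2 * Xloc a u) = Yloc a (u ^ 2) := by
      simp only at h1
      linear_combination h1
    rw [div_eq_iff h2] at h3
    exact h3

lemma exists_glue {r : ℕ → ℝ} (hr : Monotone r) {f : ℕ → ℂ → ℂ}
    (hf : ∀ n, Set.EqOn (f (n + 1)) (f n) (ball 0 (r n))) (hcov : ∀ u : ℂ, ‖u‖ < 1 → ∃ n, ‖u‖ < r n)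
    (hr1 : ∀ n, r n ≤ 1) :
    ∃ F : ℂ → ℂ, ∀ n, Set.EqOn F (f n) (ball 0 (r n)) := by
  classical
  have hmono : ∀ n k, Set.EqOn (f (n + k)) (f n) (ball 0 (r n)) := by
    intro n k
    induction k with
    | zero => exact fun _ _ => rfl
    | succ k ih =>
      intro u hu
      rw [← add_assoc, hf (n + k) (ball_subset_ball (hr (Nat.le_add_right n k)) hu)]
      exact ih hu
  refine ⟨fun u => if h : ‖u‖ < 1 then f (Nat.find (hcov u h)) u else 0, fun n u hu => ?_⟩
  have hu' : ‖u‖ < r n := by simpa using hu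
  have h1 : ‖u‖ < 1 := hu'.trans_le (hr1 n)
  simp only [h1, dif_pos]
  set m := Nat.find (hcov u h1) with hm
  have h2 : ‖u‖ < r m := Nat.find_spec (hcov u h1)
  have h3 : m ≤ n := Nat.find_min' (hcov u h1) hu'
  obtain ⟨k, rfl⟩ := Nat.exists_eq_add_of_le h3
  exact (hmono m k (by simpa using h2)).symm

theorem BPair.exists_global {a : ℂ} {r₀ : ℝ} {X₀ Y₀ : ℂ → ℂ} (h₀ : BPair a r₀ X₀ Y₀)
    (haP : a ∉ Pinf) : ∃ X Y : ℂ → ℂ, BPair a 1 X Y ∧ Set.EqOn X X₀ (ball 0 r₀) := by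
  let T := {p : ℝ × (ℂ → ℂ) × (ℂ → ℂ) // BPair a p.1 p.2.1 p.2.2}
  have hstep : ∀ t : T, ∃ t' : T, t'.1.1 = √t.1.1 ∧ Set.EqOn t'.1.2.1 t.1.2.1 (ball 0 t.1.1) ∧
      Set.EqOn t'.1.2.2 t.1.2.2 (ball 0 t.1.1) := by
    rintro ⟨⟨r, X, Y⟩, h⟩
    obtain ⟨X', Y', h', hX, hY⟩ := h.extend haP
    exact ⟨⟨⟨√r, X', Y'⟩, h'⟩, rfl, hX, hY⟩
  choose step hs1 hs2 hs3 using hstep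
  let t : ℕ → T := fun n => step^[n] ⟨⟨r₀, X₀, Y₀⟩, h₀⟩
  have ht : ∀ n, t (n + 1) = step (t n) := fun n => Function.iterate_succ_apply' _ _ _
  set r : ℕ → ℝ := fun n => (t n).1.1 with hr
  have hB : ∀ n, BPair a (r n) (t n).1.2.1 (t n).1.2.2 := fun n => (t n).2
  have hrs : ∀ n, r (n + 1) = √(r n) := fun n => by
    simp only [hr]
    rw [ht, hs1]
  have hrp : ∀ n, r n ^ (2 ^ n) = r₀ := by
    intro n
    induction n with
    | zero => simp [hr, t]
    | succ n ih =>
      rw [pow_succ', pow_mul, hrs, Real.sq_sqrt (hB n).r_pos.le, ih]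
  have hmono : Monotone r := by
    refine monotone_nat_of_le_succ (fun n => ?_)
    rw [hrs]
    have h1 := (hB n).r_pos
    have h2 := (hB n).r_le
    exact Real.le_sqrt_of_sq_le (by nlinarith)
  have hcov : ∀ u : ℂ, ‖u‖ < 1 → ∃ n, ‖u‖ < r n := by
    intro u hu
    have h1 := (tendsto_pow_two_pow hu).eventually (ball_mem_nhds 0 h₀.r_pos)
    obtain ⟨n, hn⟩ := h1.exists
    refine ⟨n, ?_⟩
    rw [dist_zero_right, norm_pow, ← hrp n] at hn
    exact lt_of_pow_lt_pow_left₀ _ (hB n).r_pos.le hn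
  obtain ⟨X, hX⟩ := exists_glue hmono (f := fun n => (t n).1.2.1)
    (fun n => by simp only [ht]; exact hs2 (t n)) hcov (fun n => (hB n).r_le)
  obtain ⟨Y, hY⟩ := exists_glue hmono (f := fun n => (t n).1.2.2)
    (fun n => by simp only [ht]; exact hs3 (t n)) hcov (fun n => (hB n).r_le)
  have hn : ∀ n, ∀ u ∈ ball (0 : ℂ) (r n), ball (0 : ℂ) (r n) ∈ 𝓝 u := fun n u hu =>
    isOpen_ball.mem_nhds hu
  have hXloc : Set.EqOn X X₀ (ball 0 r₀) := by simpa [hr, t] using hX 0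
  refine ⟨X, Y, ⟨one_pos, le_rfl, h₀.ha, ?_, ?_, ?_, ?_, ?_, ?_, ?_⟩, hXloc⟩
  · intro u hu
    obtain ⟨n, hun⟩ := hcov u (by simpa using hu)
    have hun' : u ∈ ball (0 : ℂ) (r n) := by simpa using hun
    exact (((hB n).dX.differentiableAt (hn n u hun')).congr_of_eventuallyEq
      ((hX n).eventuallyEq_of_mem (hn n u hun'))).differentiableWithinAt
  · intro u hu
    obtain ⟨n, hun⟩ := hcov u (by simpa using hu)
    have hun' : u ∈ ball (0 : ℂ) (r n) := by simpa using hun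
    exact (((hB n).dY.differentiableAt (hn n u hun')).congr_of_eventuallyEq
      ((hY n).eventuallyEq_of_mem (hn n u hun'))).differentiableWithinAt
  · rw [hX 0 (hB 0).zero_mem, (hB 0).X0]
  · rw [hY 0 (hB 0).zero_mem, (hB 0).Y0]
  · exact (hB 0).dX0.congr_of_eventuallyEq ((hX 0).eventuallyEq_of_mem (hn 0 0 (hB 0).zero_mem))
  · intro u hu
    obtain ⟨n, hun⟩ := hcov u (by simpa using hu)
    have hun' : u ∈ ball (0 : ℂ) (r n) := by simpa using hun
    rw [hX n hun', hY n hun']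
    exact (hB n).e1 u hun'
  · intro u hu
    obtain ⟨n, hun⟩ := hcov u (by simpa using hu)
    have hun' : u ∈ ball (0 : ℂ) (r n) := by simpa using hun
    rw [hX n hun', hY n ((hB n).sq_mem hun')]
    exact (hB n).e2 u hun'

/-- The global parametrization, with good local behaviour for every bound on the parameter. -/
theorem exists_chi (a : ℂ) (ha0 : a ≠ 0) (haP : a ∉ Pinf) :
    ∃ X Y : ℂ → ℂ, BPair a 1 X Y ∧
      ∀ A, 0 < A → ‖a‖ < A → Set.EqOn X (Xloc a) (ball 0 (rhoA A)) := by
  have h1 : 0 < ‖a‖ + 1 := by positivity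
  obtain ⟨X, Y, h, hX⟩ := (bpair_loc h1 ha0 (lt_add_one _)).exists_global haP
  refine ⟨X, Y, h, fun A hA haA => ?_⟩
  have hb := bpair_loc hA ha0 haA
  have hsub : ball (0 : ℂ) (rhoA A) ⊆ ball 0 1 := ball_subset_ball hb.r_le
  refine AnalyticOnNhd.eqOn_of_preconnected_of_eventuallyEq (z₀ := 0)
    ((h.dX.mono hsub).analyticOnNhd isOpen_ball) (hb.dX.analyticOnNhd isOpen_ball)
    (convex_ball _ _).isPreconnected hb.zero_mem ?_
  exact hX.eventuallyEq_of_mem (ball_mem_nhds _ (rhoA_pos h1))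

/-- The global Boettcher parametrization of `A_∞` in the coordinate `1/z`. -/
noncomputable def chi (a : ℂ) : ℂ → ℂ :=
  open Classical in
  if h : a ≠ 0 ∧ a ∉ Pinf then Classical.choose (exists_chi a h.1 h.2) else 0

lemma chi_spec {a : ℂ} (ha0 : a ≠ 0) (haP : a ∉ Pinf) :
    ∃ Y : ℂ → ℂ, BPair a 1 (chi a) Y ∧
      ∀ A, 0 < A → ‖a‖ < A → Set.EqOn (chi a) (Xloc a) (ball 0 (rhoA A)) := by
  have h : a ≠ 0 ∧ a ∉ Pinf := ⟨ha0, haP⟩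
  have := Classical.choose_spec (exists_chi a h.1 h.2)
  rw [chi, dif_pos h]
  exact this

lemma holo_deriv {N : Set ℂ} (hN : IsOpen N) {g : ℂ → ℂ → ℂ} {u : ℂ} {s M : ℝ} (hs : 0 < s)
    (hd : ∀ a ∈ N, DifferentiableOn ℂ (g a) (ball u s))
    (hM : ∀ a ∈ N, ∀ v ∈ ball u s, ‖g a v‖ ≤ M)
    (hp : ∀ v ∈ ball u s, DifferentiableOn ℂ (fun a => g a v) N) :
    DifferentiableOn ℂ (fun a => deriv (g a) u) N := by
  have hu : u ∈ ball u s := mem_ball_self hs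
  set v : ℕ → ℂ := fun n => u + ((s / (n + 2) : ℝ) : ℂ) with hv
  have hsn : ∀ n : ℕ, 0 < s / ((n : ℝ) + 2) := fun n => by positivity
  have hdist : ∀ n, dist (v n) u = s / (n + 2) := fun n => by
    rw [dist_eq_norm, hv]
    simp only [add_sub_cancel_left, Complex.norm_real, Real.norm_eq_abs]
    exact abs_of_pos (hsn n)
  have hvm : ∀ n, v n ∈ ball u s := fun n => by
    rw [mem_ball, hdist, div_lt_iff₀ (by positivity)]
    nlinarith [(Nat.cast_nonneg n : (0 : ℝ) ≤ n)]
  have hvne : ∀ n, v n ≠ u := fun n h => by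
    have := hdist n
    rw [h, dist_self] at this
    exact (hsn n).ne this
  have hK : ∀ a ∈ N, ∀ w ∈ ball u s, ‖dslope (g a) u w‖ ≤ 2 * M / s := by
    intro a ha w hw
    refine Complex.norm_dslope_le_div_of_mapsTo_ball (hd a ha) (fun w hw => ?_) hw
    rw [mem_closedBall, dist_eq_norm]
    linarith [norm_sub_le (g a w) (g a u), hM a ha w hw, hM a ha u hu]
  have hL : ∀ a ∈ N, ∀ w ∈ ball u s, dist (dslope (g a) u w) (deriv (g a) u) ≤
      (2 * (2 * M / s)) / s * dist w u := by
    intro a ha w hw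
    rw [← dslope_same (g a) u]
    refine Complex.dist_le_div_mul_dist_of_mapsTo_ball
      ((Complex.differentiableOn_dslope (ball_mem_nhds u hs)).2 (hd a ha)) (fun w hw => ?_) hw
    rw [mem_closedBall, dist_eq_norm]
    linarith [norm_sub_le (dslope (g a) u w) (dslope (g a) u u), hK a ha w hw, hK a ha u hu]
  have hlim : Tendsto (fun n : ℕ => (2 * (2 * M / s)) / s * (s / ((n : ℝ) + 2))) atTop (𝓝 0) := by
    have h1 : Tendsto (fun n : ℕ => (n : ℝ) + 2) atTop atTop :=
      tendsto_atTop_add_const_right _ _ tendsto_natCast_atTop_atTop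
    have := (h1.const_div_atTop s).const_mul ((2 * (2 * M / s)) / s)
    simpa using this
  have hT : TendstoUniformlyOn (fun n a => dslope (g a) u (v n)) (fun a => deriv (g a) u) atTop N := by
    rw [Metric.tendstoUniformlyOn_iff]
    intro ε hε
    filter_upwards [hlim.eventually (gt_mem_nhds hε)] with n hn a ha
    rw [dist_comm]
    refine lt_of_le_of_lt ?_ hn
    rw [← hdist n]
    exact hL a ha _ (hvm n)
  refine hT.tendstoLocallyUniformlyOn.differentiableOn (Eventually.of_forall fun n => ?_) hN
  have : (fun a => dslope (g a) u (v n)) = fun a => (v n - u)⁻¹ * (g a (v n) - g a u) := by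
    funext a
    rw [dslope_of_ne _ (hvne n), slope_def_module, smul_eq_mul]
  rw [this]
  exact ((hp _ (hvm n)).sub (hp _ hu)).const_mul _

lemma iter_diff {f : ℂ → ℂ} {s : Set ℂ} (hs : IsOpen s) (hf : DifferentiableOn ℂ f s) (n : ℕ) :
    DifferentiableOn ℂ (iteratedDeriv n f) s := by
  induction n with
  | zero => simpa [iteratedDeriv_zero] using hf
  | succ n ih =>
    rw [iteratedDeriv_succ]
    exact ih.deriv hs

lemma holo_param {N : Set ℂ} (hN : IsOpen N) {F : ℂ → ℂ → ℂ} {ρ M : ℝ} (hρ : 0 < ρ) (hρ1 : ρ < 1)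
    (hd : ∀ a ∈ N, DifferentiableOn ℂ (F a) (ball 0 1))
    (hM : ∀ a ∈ N, ∀ v ∈ ball (0 : ℂ) 1, ‖F a v‖ ≤ M)
    (hp : ∀ v ∈ ball (0 : ℂ) ρ, DifferentiableOn ℂ (fun a => F a v) N) :
    ∀ u ∈ ball (0 : ℂ) 1, DifferentiableOn ℂ (fun a => F a u) N := by
  have est : ∀ (n : ℕ), ∀ a ∈ N, ∀ (w : ℂ) (R : ℝ), 0 < R → ‖w‖ + R < 1 →
      ‖iteratedDeriv n (F a) w‖ ≤ n.factorial * M / R ^ n := by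
    intro n a ha w R hR hw
    have hsub : closedBall w R ⊆ ball (0 : ℂ) 1 := by
      intro z hz
      rw [mem_closedBall, dist_eq_norm] at hz
      rw [mem_ball_zero_iff]
      have := norm_add_le (z - w) w
      rw [sub_add_cancel] at this
      linarith
    refine Complex.norm_iteratedDeriv_le_of_forall_mem_sphere_norm_le n hR ?_ fun z hz =>
      hM a ha z (hsub (sphere_subset_closedBall hz))
    refine DifferentiableOn.diffContOnCl ?_
    rw [closure_ball _ hR.ne']
    exact (hd a ha).mono hsub
  have hit : ∀ n : ℕ, ∀ w ∈ ball (0 : ℂ) ρ,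
      DifferentiableOn ℂ (fun a => iteratedDeriv n (F a) w) N := by
    intro n
    induction n with
    | zero => simpa [iteratedDeriv_zero] using hp
    | succ n ih =>
      intro w hw
      rw [mem_ball_zero_iff] at hw
      simp only [iteratedDeriv_succ]
      have hsub : ball w (ρ - ‖w‖) ⊆ ball (0 : ℂ) ρ := by
        intro z hz
        rw [mem_ball, dist_eq_norm] at hz
        rw [mem_ball_zero_iff]
        have := norm_add_le (z - w) w
        rw [sub_add_cancel] at this
        linarith
      refine holo_deriv hN (g := fun a => iteratedDeriv n (F a)) (s := ρ - ‖w‖)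
        (M := n.factorial * M / ((1 - ρ) / 2) ^ n) (by linarith) ?_ ?_ ?_
      · intro a ha
        exact (iter_diff isOpen_ball (hd a ha) n).mono
          (hsub.trans (ball_subset_ball hρ1.le))
      · intro a ha v hv
        have := mem_ball_zero_iff.1 (hsub hv)
        exact est n a ha v _ (by linarith) (by linarith)
      · intro v hv
        exact ih v (hsub hv)
  intro u hu
  rw [mem_ball_zero_iff] at hu
  obtain ⟨R, huR, hR1⟩ := exists_between hu
  have hR0 : 0 < R := (norm_nonneg _).trans_lt huR
  have h0 : (0 : ℂ) ∈ ball (0 : ℂ) ρ := mem_ball_self hρ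
  have hsum : Summable (fun n : ℕ => M * (‖u‖ / R) ^ n) :=
    (summable_geometric_of_lt_one (by positivity) ((div_lt_one hR0).2 huR)).mul_left M
  have hT := tendstoUniformlyOn_tsum_nat (s := N) hsum
    (f := fun n a => ((n.factorial : ℂ)⁻¹ • (u - 0) ^ n • iteratedDeriv n (F a) 0)) (by
      intro n a ha
      have h1 := est n a ha 0 R hR0 (by simpa using hR1)
      have hf : (0 : ℝ) < n.factorial := by exact_mod_cast n.factorial_pos
      rw [norm_smul, norm_smul, norm_inv, norm_pow, sub_zero, Complex.norm_natCast]
      calc (n.factorial : ℝ)⁻¹ * (‖u‖ ^ n * ‖iteratedDeriv n (F a) 0‖)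
          ≤ (n.factorial : ℝ)⁻¹ * (‖u‖ ^ n * (n.factorial * M / R ^ n)) := by gcongr
        _ = M * (‖u‖ / R) ^ n := by
          rw [div_pow]; field_simp)
  have h2 := hT.tendstoLocallyUniformlyOn.differentiableOn (Eventually.of_forall fun n => ?_) hN
  · refine h2.congr fun a ha => ?_
    exact (Complex.hasSum_taylorSeries_on_ball (hd a ha) (by simpa using hu)).tsum_eq.symm
  · refine DifferentiableOn.fun_sum fun i _ => ?_
    simp only [smul_eq_mul]
    exact ((hit i 0 h0).const_mul _).const_mul _

/-- The good parameter set. -/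
def goodU : Set ℂ := {a : ℂ | a ≠ 0 ∧ a ∉ closure Pinf}

lemma isOpen_goodU : IsOpen goodU :=
  isOpen_ne.inter isClosed_closure.isOpen_compl

lemma goodU.notP {a : ℂ} (ha : a ∈ goodU) : a ∉ Pinf := fun h => ha.2 (subset_closure h)

lemma chi_bpair {a : ℂ} (ha : a ∈ goodU) : ∃ Y, BPair a 1 (chi a) Y :=
  let ⟨Y, h, _⟩ := chi_spec ha.1 (goodU.notP ha)
  ⟨Y, h⟩

lemma chi_bound {a₁ : ℂ} (ha : a₁ ∈ goodU) : ∃ r > 0, ∃ M > 0, ball a₁ r ⊆ goodU ∧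
    ∀ a ∈ ball a₁ r, ∀ u ∈ ball (0 : ℂ) 1, ‖chi a u‖ ≤ M := by
  obtain ⟨r, hr, hsub⟩ := Metric.isOpen_iff.1 isOpen_goodU a₁ ha
  have ha0 : 0 < ‖a₁‖ := norm_pos_iff.2 ha.1
  refine ⟨min r (‖a₁‖ / 2), by positivity, max 1 (36 / (‖a₁‖ / 2)), by positivity,
    (ball_subset_ball (min_le_left _ _)).trans hsub, fun a haa u hu => ?_⟩
  have haU := hsub (ball_subset_ball (min_le_left _ _) haa)
  obtain ⟨Y, h⟩ := chi_bpair haU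
  refine (h.bound hu).trans (max_le_max le_rfl ?_)
  have h2 : dist a a₁ < ‖a₁‖ / 2 := (mem_ball.1 haa).trans_le (min_le_right _ _)
  rw [dist_eq_norm] at h2
  have := norm_sub_norm_le a₁ a
  rw [norm_sub_rev] at this
  gcongr
  linarith

lemma chi_holo {u : ℂ} (hu : u ∈ ball (0 : ℂ) 1) : DifferentiableOn ℂ (fun a => chi a u) goodU := by
  intro a₁ ha₁
  obtain ⟨r, hr, M, hM0, hsub, hM⟩ := chi_bound ha₁
  set A := ‖a₁‖ + r with hA
  have hA0 : 0 < A := by positivity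
  have hlt : ∀ a ∈ ball a₁ r, ‖a‖ < A := fun a ha => by
    rw [mem_ball, dist_eq_norm] at ha
    have := norm_add_le (a - a₁) a₁
    rw [sub_add_cancel] at this
    linarith
  have hρ1 : rhoA A < 1 := by
    rw [rhoA, div_lt_one (by positivity)]; linarith
  have := holo_param (N := ball a₁ r) isOpen_ball (F := chi) (rhoA_pos hA0) hρ1
    (fun a ha => (chi_bpair (hsub ha)).elim fun Y h => h.dX) hM (fun v hv => by
      refine ((Xloc_diff_a hA0 (mem_ball_zero_iff.1 hv)).mono fun a ha =>
        mem_ball_zero_iff.2 (hlt a ha)).congr fun a ha => ?_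
      obtain ⟨Y, h, he⟩ := chi_spec (hsub ha).1 (goodU.notP (hsub ha))
      exact he A hA0 (hlt a ha) hv) u hu
  exact (this.differentiableAt (ball_mem_nhds _ hr)).differentiableWithinAt

lemma chi_injOn {a : ℂ} (ha : a ∈ goodU) : Set.InjOn (chi a) (ball 0 1) :=
  (chi_bpair ha).elim fun _ h => h.injOnX

lemma chi_uc_loc {a₁ : ℂ} (ha₁ : a₁ ∈ goodU) : ∃ s > 0, ball a₁ s ⊆ goodU ∧
    ∀ ε > 0, ∃ δ > 0, ∀ u ∈ ball (0 : ℂ) 1, ∀ v ∈ ball (0 : ℂ) 1, ∀ a ∈ ball a₁ s,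
      (‖chi a₁ u - chi a₁ v‖ < δ → ‖chi a u - chi a v‖ < ε) ∧
      (‖chi a u - chi a v‖ < δ → ‖chi a₁ u - chi a₁ v‖ < ε) := by
  obtain ⟨r, hr, M, hM0, hsub, hM⟩ := chi_bound ha₁
  refine ⟨r / 4, by positivity, (ball_subset_ball (by linarith)).trans hsub, fun ε hε => ?_⟩
  obtain ⟨δ, hδ, H⟩ := harnack_eps (M := 2 * M + 1) (by positivity) hε
  refine ⟨δ, hδ, fun u hu v hv a ha => ?_⟩
  rcases eq_or_ne u v with rfl | huv
  · simp [hε]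
  have hd : DifferentiableOn ℂ (fun a => chi a u - chi a v) (ball a₁ r) :=
    ((chi_holo hu).sub (chi_holo hv)).mono hsub
  have hne : ∀ b ∈ ball a₁ r, chi b u - chi b v ≠ 0 := fun b hb h0 =>
    huv (chi_injOn (hsub hb) hu hv (sub_eq_zero.1 h0))
  have hbd : ∀ b ∈ ball a₁ r, ‖chi b u - chi b v‖ < 2 * M + 1 := fun b hb => by
    linarith [norm_sub_le (chi b u) (chi b v), hM b hb u hu, hM b hb v hv]
  rw [mem_ball] at ha
  refine ⟨fun h => H (h := fun a => chi a u - chi a v) hr hd hne hbd h a (by linarith), fun h => ?_⟩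
  have hs2 : ball a (r / 2) ⊆ ball a₁ r := by
    intro z hz
    rw [mem_ball] at hz ⊢
    linarith [dist_triangle z a a₁]
  exact H (h := fun a => chi a u - chi a v) (half_pos hr) (hd.mono hs2) (fun b hb => hne b (hs2 hb))
    (fun b hb => hbd b (hs2 hb)) h a₁ (by rw [dist_comm]; linarith)

/-- Uniform continuity of `chi b ∘ (chi a)⁻¹`. -/
def chiUC (a b : ℂ) : Prop := ∀ ε > 0, ∃ δ > 0, ∀ u ∈ ball (0 : ℂ) 1, ∀ v ∈ ball (0 : ℂ) 1,
  ‖chi a u - chi a v‖ < δ → ‖chi b u - chi b v‖ < ε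

lemma chiUC.trans {a b c : ℂ} (h : chiUC a b) (h' : chiUC b c) : chiUC a c := by
  intro ε hε
  obtain ⟨δ, hδ, H⟩ := h' ε hε
  obtain ⟨δ', hδ', H'⟩ := h δ hδ
  exact ⟨δ', hδ', fun u hu v hv h => H u hu v hv (H' u hu v hv h)⟩

lemma chiUC_of_component {C : Set ℂ} (hC : IsPreconnected C) (hCU : C ⊆ goodU) {a b : ℂ}
    (ha : a ∈ C) (hb : b ∈ C) : chiUC a b ∧ chiUC b a := by
  refine hC.induction₂ (fun a b => chiUC a b ∧ chiUC b a) (fun x hx => ?_)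
    (fun x y z _ _ _ h h' => ⟨h.1.trans h'.1, h'.2.trans h.2⟩) (fun x y _ _ h => ⟨h.2, h.1⟩) ha hb
  obtain ⟨s, hs, hsub, H⟩ := chi_uc_loc (hCU hx)
  refine mem_nhdsWithin_of_mem_nhds ?_
  filter_upwards [ball_mem_nhds x hs] with y hy
  refine ⟨fun ε hε => ?_, fun ε hε => ?_⟩
  · obtain ⟨δ, hδ, K⟩ := H ε hε
    exact ⟨δ, hδ, fun u hu v hv => (K u hu v hv y hy).1⟩
  · obtain ⟨δ, hδ, K⟩ := H ε hε
    exact ⟨δ, hδ, fun u hu v hv => (K u hu v hv y hy).2⟩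

lemma chiUC.tendsto {a b : ℂ} (h : chiUC a b) {u v : ℕ → ℂ} (hu : ∀ n, u n ∈ ball (0 : ℂ) 1)
    (hv : ∀ n, v n ∈ ball (0 : ℂ) 1)
    (ht : Tendsto (fun n => chi a (u n) - chi a (v n)) atTop (𝓝 0)) :
    Tendsto (fun n => chi b (u n) - chi b (v n)) atTop (𝓝 0) := by
  rw [Metric.tendsto_nhds] at ht ⊢
  intro ε hε
  obtain ⟨δ, hδ, H⟩ := h ε hε
  filter_upwards [ht δ hδ] with n hn
  rw [dist_zero_right] at hn ⊢
  exact H _ (hu n) _ (hv n) hn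

lemma chiUC.cauchy {a b : ℂ} (h : chiUC a b) {u : ℕ → ℂ} (hu : ∀ n, u n ∈ ball (0 : ℂ) 1)
    (ht : CauchySeq (fun n => chi a (u n))) : CauchySeq (fun n => chi b (u n)) := by
  rw [Metric.cauchySeq_iff] at ht ⊢
  intro ε hε
  obtain ⟨δ, hδ, H⟩ := h ε hε
  obtain ⟨N, hN⟩ := ht δ hδ
  refine ⟨N, fun m hm n hn => ?_⟩
  have := hN m hm n hn
  rw [dist_eq_norm] at this ⊢
  exact H _ (hu m) _ (hu n) this

/-- The image of the unit disk. -/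
def chiV (a : ℂ) : Set ℂ := chi a '' ball 0 1

lemma isOpen_chiV {a : ℂ} (ha : a ∈ goodU) : IsOpen (chiV a) :=
  (chi_bpair ha).elim fun _ h => h.openX subset_rfl isOpen_ball

lemma component_motion {C : Set ℂ} (hC : IsPreconnected C) (hCo : IsOpen C) (hCU : C ⊆ goodU)
    {b : ℂ} (hb : b ∈ C) : ∃ Φ : ℂ → ℂ → ℂ,
      (∀ ξ ∈ closure (chiV b), Φ b ξ = ξ) ∧
      (∀ ξ ∈ closure (chiV b), DifferentiableOn ℂ (fun a => Φ a ξ) C) ∧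
      ∀ a ∈ C, Set.BijOn (Φ a) (frontier (chiV b)) (frontier (chiV a)) ∧
        ∀ u ∈ ball (0 : ℂ) 1, Φ a (chi b u) = chi a u := by
  have hex : ∀ ξ : ℂ, ∃ u : ℕ → ℂ, ξ ∈ closure (chiV b) →
      (∀ n, u n ∈ ball (0 : ℂ) 1) ∧ Tendsto (fun n => chi b (u n)) atTop (𝓝 ξ) := by
    intro ξ
    by_cases h : ξ ∈ closure (chiV b)
    · obtain ⟨x, hx, hxt⟩ := mem_closure_iff_seq_limit.1 h
      choose u hu hux using hx
      exact ⟨u, fun _ => ⟨hu, by simpa only [hux] using hxt⟩⟩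
    · exact ⟨fun _ => 0, fun h' => absurd h' h⟩
  choose u hu using hex
  have uc : ∀ a ∈ C, chiUC b a ∧ chiUC a b := fun a ha => chiUC_of_component hC hCU hb ha
  have hlim : ∀ a ξ, ∃ η, a ∈ C → ξ ∈ closure (chiV b) →
      Tendsto (fun n => chi a (u ξ n)) atTop (𝓝 η) := by
    intro a ξ
    by_cases h : a ∈ C ∧ ξ ∈ closure (chiV b)
    · obtain ⟨η, hη⟩ := cauchySeq_tendsto_of_complete
        ((uc a h.1).1.cauchy (hu ξ h.2).1 (hu ξ h.2).2.cauchySeq)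
      exact ⟨η, fun _ _ => hη⟩
    · exact ⟨0, fun h1 h2 => absurd ⟨h1, h2⟩ h⟩
  choose Φ hΦ using hlim
  have gen : ∀ a ∈ C, ∀ ξ ∈ closure (chiV b), ∀ w : ℕ → ℂ, (∀ n, w n ∈ ball (0 : ℂ) 1) →
      Tendsto (fun n => chi b (w n)) atTop (𝓝 ξ) →
      Tendsto (fun n => chi a (w n)) atTop (𝓝 (Φ a ξ)) := by
    intro a ha ξ hξ w hw hwt
    have h1 := hwt.sub (hu ξ hξ).2
    rw [sub_self] at h1
    have h2 := ((uc a ha).1.tendsto hw (hu ξ hξ).1 h1).add (hΦ a ξ ha hξ)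
    simpa using h2
  have hchi : ∀ a ∈ C, ∀ v ∈ ball (0 : ℂ) 1, Φ a (chi b v) = chi a v := by
    intro a ha v hv
    exact tendsto_nhds_unique
      (gen a ha (chi b v) (subset_closure ⟨v, hv, rfl⟩) (fun _ => v) (fun _ => hv)
        tendsto_const_nhds) tendsto_const_nhds
  refine ⟨Φ, ?_, ?_, fun a ha => ⟨?_, hchi a ha⟩⟩
  · intro ξ hξ
    exact tendsto_nhds_unique (hΦ b ξ hb hξ) (hu ξ hξ).2
  · intro ξ hξ
    have hT : TendstoLocallyUniformlyOn (fun n a => chi a (u ξ n)) (fun a => Φ a ξ) atTop C := by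
      rw [Metric.tendstoLocallyUniformlyOn_iff]
      intro ε hε a₁ ha₁
      obtain ⟨s, hs, hsub, H⟩ := chi_uc_loc (hCU ha₁)
      obtain ⟨δ, hδ, K⟩ := H (ε / 2) (half_pos hε)
      obtain ⟨N, hN⟩ := Metric.cauchySeq_iff.1 (hΦ a₁ ξ ha₁ hξ).cauchySeq δ hδ
      refine ⟨ball a₁ s ∩ C, inter_mem (mem_nhdsWithin_of_mem_nhds (ball_mem_nhds _ hs))
        self_mem_nhdsWithin, ?_⟩
      filter_upwards [eventually_ge_atTop N] with n hn a ha
      have h1 : ∀ᶠ m in atTop, dist (chi a (u ξ m)) (chi a (u ξ n)) ≤ ε / 2 := by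
        filter_upwards [eventually_ge_atTop N] with m hm
        have := hN m hm n hn
        rw [dist_eq_norm] at this ⊢
        exact ((K _ ((hu ξ hξ).1 m) _ ((hu ξ hξ).1 n) a ha.1).1 this).le
      have h2 := le_of_tendsto ((hΦ a ξ ha.2 hξ).dist tendsto_const_nhds) h1
      linarith
    refine hT.differentiableOn (Eventually.of_forall fun n => ?_) hCo
    exact (chi_holo ((hu ξ hξ).1 n)).mono hCU
  · have hfb : frontier (chiV b) = closure (chiV b) \ chiV b := (isOpen_chiV (hCU hb)).frontier_eq
    have hfa : frontier (chiV a) = closure (chiV a) \ chiV a := (isOpen_chiV (hCU ha)).frontier_eq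
    have hinj : Set.InjOn (Φ a) (closure (chiV b)) := by
      intro ξ hξ ξ' hξ' he
      have h1 := (hΦ a ξ ha hξ).sub (hΦ a ξ' ha hξ')
      rw [he, sub_self] at h1
      have h2 := (uc a ha).2.tendsto (hu ξ hξ).1 (hu ξ' hξ').1 h1
      exact sub_eq_zero.1 (tendsto_nhds_unique ((hu ξ hξ).2.sub (hu ξ' hξ').2) h2)
    rw [hfb, hfa]
    refine ⟨?_, hinj.mono Set.sdiff_subset, ?_⟩
    · rintro ξ ⟨hξ, hξn⟩
      refine ⟨mem_closure_of_tendsto (hΦ a ξ ha hξ) (Eventually.of_forall fun n =>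
        ⟨_, (hu ξ hξ).1 n, rfl⟩), ?_⟩
      rintro ⟨v, hv, hve⟩
      refine hξn ⟨v, hv, ?_⟩
      refine hinj (subset_closure ⟨v, hv, rfl⟩) hξ ?_
      rw [hchi a ha v hv, hve]
    · rintro η ⟨hη, hηn⟩
      obtain ⟨x, hx, hxt⟩ := mem_closure_iff_seq_limit.1 hη
      choose w hw hwx using hx
      replace hxt : Tendsto (fun n => chi a (w n)) atTop (𝓝 η) := by simpa only [hwx] using hxt
      obtain ⟨ξ, hξ⟩ := cauchySeq_tendsto_of_complete ((uc a ha).2.cauchy hw hxt.cauchySeq)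
      have hξc : ξ ∈ closure (chiV b) := mem_closure_of_tendsto hξ (Eventually.of_forall fun n =>
        ⟨_, hw n, rfl⟩)
      have he : Φ a ξ = η := tendsto_nhds_unique (gen a ha ξ hξc w hw hξ) hxt
      refine ⟨ξ, ⟨hξc, ?_⟩, he⟩
      rintro ⟨v, hv, rfl⟩
      refine hηn ⟨v, hv, ?_⟩
      rw [← he, hchi a ha v hv]

lemma zero_mem_chiV {a : ℂ} (ha : a ∈ goodU) : (0 : ℂ) ∈ chiV a :=
  (chi_bpair ha).elim fun _ h => ⟨0, h.zero_mem, h.X0⟩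

lemma chiV_bound {a : ℂ} (ha : a ∈ goodU) : ∃ M > 0, ∀ w ∈ chiV a, ‖w‖ ≤ M := by
  obtain ⟨Y, h⟩ := chi_bpair ha
  refine ⟨max 1 (36 / ‖a‖), by positivity, ?_⟩
  rintro _ ⟨u, hu, rfl⟩
  exact h.bound hu

lemma card_frontier {V : Set ℂ} (hV : IsOpen V) (h0 : (0 : ℂ) ∈ V) {M : ℝ}
    (hM : ∀ w ∈ V, ‖w‖ ≤ M) : Cardinal.mk (frontier V) = Cardinal.continuum := by
  refine le_antisymm ((Cardinal.mk_set_le _).trans_eq Cardinal.mk_complex) ?_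
  obtain ⟨ε, hε, hsub⟩ := Metric.isOpen_iff.1 hV 0 h0
  have key : Set.Ioo (-ε) ε ⊆ Complex.im '' frontier V := by
    intro y hy
    have hg : Continuous (fun x : ℝ => (x : ℂ) + (y : ℂ) * Complex.I) := by fun_prop
    have hne : (frontier ((fun x : ℝ => (x : ℂ) + (y : ℂ) * Complex.I) ⁻¹' V)).Nonempty := by
      rw [nonempty_frontier_iff]
      refine ⟨⟨0, hsub ?_⟩, fun h => ?_⟩
      · rw [mem_ball_zero_iff]
        simpa using abs_lt.2 hy
      · have h1 : |M| + 1 ∈ (fun x : ℝ => (x : ℂ) + (y : ℂ) * Complex.I) ⁻¹' V := by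
          rw [h]; trivial
        have h2 := hM _ h1
        have h3 := Complex.abs_re_le_norm (((|M| + 1 : ℝ) : ℂ) + (y : ℂ) * Complex.I)
        have h4 : (((|M| + 1 : ℝ) : ℂ) + (y : ℂ) * Complex.I).re = |M| + 1 := by simp
        rw [h4] at h3
        linarith [le_abs_self M, le_abs_self (|M| + 1)]
    obtain ⟨x, hx⟩ := hne
    refine ⟨_, hg.frontier_preimage_subset V hx, by simp⟩
  rw [← Cardinal.mk_Ioo_real (show -ε < ε by linarith)]
  exact (Cardinal.mk_le_mk_of_subset key).trans Cardinal.mk_image_le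

lemma exists_base_change {a b : ℂ} (ha : a ∈ goodU) (hb : b ∈ goodU) : ∃ e : ℂ → ℂ,
    (a = b → e = id) ∧ Set.BijOn e (frontier (chiV a)) (frontier (chiV b)) ∧
      ∀ u ∈ ball (0 : ℂ) 1, e (chi a u) = chi b u := by
  classical
  by_cases hab : a = b
  · subst hab
    exact ⟨id, fun _ => rfl, Set.bijOn_id _, fun _ _ => rfl⟩
  obtain ⟨M, _, hM⟩ := chiV_bound ha
  obtain ⟨M', _, hM'⟩ := chiV_bound hb
  have hc : Cardinal.mk (frontier (chiV a)) = Cardinal.mk (frontier (chiV b)) := by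
    rw [card_frontier (isOpen_chiV ha) (zero_mem_chiV ha) hM,
      card_frontier (isOpen_chiV hb) (zero_mem_chiV hb) hM']
  obtain ⟨f⟩ := Cardinal.eq.1 hc
  set e : ℂ → ℂ := fun ξ => if h : ξ ∈ frontier (chiV a) then (f ⟨ξ, h⟩ : ℂ) else
    chi b (Function.invFunOn (chi a) (ball 0 1) ξ) with he
  have hef : ∀ ξ (h : ξ ∈ frontier (chiV a)), e ξ = f ⟨ξ, h⟩ := fun ξ h => dif_pos h
  refine ⟨e, fun h => absurd h hab, ⟨?_, ?_, ?_⟩, ?_⟩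
  · intro ξ h
    rw [hef ξ h]
    exact (f ⟨ξ, h⟩).2
  · intro ξ h ξ' h' hee
    rw [hef ξ h, hef ξ' h'] at hee
    have := f.injective (Subtype.ext hee)
    exact congrArg Subtype.val this
  · intro η h
    refine ⟨(f.symm ⟨η, h⟩ : ℂ), (f.symm ⟨η, h⟩).2, ?_⟩
    rw [hef _ (f.symm ⟨η, h⟩).2]
    simp
  · intro u hu
    have hn : chi a u ∉ frontier (chiV a) := by
      rw [(isOpen_chiV ha).frontier_eq]
      exact fun h => h.2 ⟨u, hu, rfl⟩
    rw [he]
    simp only [dif_neg hn]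
    congr 1
    exact (chi_injOn ha).leftInvOn_invFunOn hu

/-- The motion of the closure in the coordinate `1/z`. -/
theorem global_motion {a₀ : ℂ} (ha₀ : a₀ ∈ goodU) : ∃ Ψ : ℂ → ℂ → ℂ,
      (∀ ξ ∈ closure (chiV a₀), Ψ a₀ ξ = ξ) ∧
      (∀ ξ ∈ closure (chiV a₀), DifferentiableOn ℂ (fun a => Ψ a ξ) goodU) ∧
      ∀ a ∈ goodU, Set.BijOn (Ψ a) (frontier (chiV a₀)) (frontier (chiV a)) ∧
        ∀ u ∈ ball (0 : ℂ) 1, Ψ a (chi a₀ u) = chi a u := by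
  classical
  -- base point of each component
  have hbase : ∀ C : Set ℂ, ∃ b : ℂ, (a₀ ∈ C → b = a₀) ∧ (C.Nonempty → b ∈ C) := by
    intro C
    by_cases h : a₀ ∈ C
    · exact ⟨a₀, fun _ => rfl, fun _ => h⟩
    · by_cases h' : C.Nonempty
      · exact ⟨h'.some, fun h1 => absurd h1 h, fun _ => h'.some_mem⟩
      · exact ⟨0, fun h1 => absurd h1 h, fun h1 => absurd h1 h'⟩
  choose β hβ0 hβ using hbase
  have hmot : ∀ C : Set ℂ, ∃ Φ : ℂ → ℂ → ℂ, IsPreconnected C → IsOpen C → C ⊆ goodU →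
      β C ∈ C → 
      (∀ ξ ∈ closure (chiV (β C)), Φ (β C) ξ = ξ) ∧
      (∀ ξ ∈ closure (chiV (β C)), DifferentiableOn ℂ (fun a => Φ a ξ) C) ∧
      ∀ a ∈ C, Set.BijOn (Φ a) (frontier (chiV (β C))) (frontier (chiV a)) ∧
        ∀ u ∈ ball (0 : ℂ) 1, Φ a (chi (β C) u) = chi a u := by
    intro C
    by_cases h : IsPreconnected C ∧ IsOpen C ∧ C ⊆ goodU ∧ β C ∈ C
    · obtain ⟨Φ, hΦ⟩ := component_motion h.1 h.2.1 h.2.2.1 h.2.2.2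
      exact ⟨Φ, fun _ _ _ _ => hΦ⟩
    · exact ⟨0, fun h1 h2 h3 h4 => absurd ⟨h1, h2, h3, h4⟩ h⟩
  choose Φ hΦ using hmot
  have hech : ∀ b : ℂ, ∃ e : ℂ → ℂ, b ∈ goodU →
      (a₀ = b → e = id) ∧ Set.BijOn e (frontier (chiV a₀)) (frontier (chiV b)) ∧
      ∀ u ∈ ball (0 : ℂ) 1, e (chi a₀ u) = chi b u := by
    intro b
    by_cases h : b ∈ goodU
    · obtain ⟨e, he⟩ := exists_base_change ha₀ h
      exact ⟨e, fun _ => he⟩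
    · exact ⟨id, fun h' => absurd h' h⟩
  choose e he using hech
  set K : ℂ → Set ℂ := fun a => connectedComponentIn goodU a with hK
  have hKsub : ∀ a, K a ⊆ goodU := fun a => connectedComponentIn_subset _ _
  have hKo : ∀ a, IsOpen (K a) := fun a => isOpen_goodU.connectedComponentIn
  have hKp : ∀ a, IsPreconnected (K a) := fun a => isPreconnected_connectedComponentIn
  have hKm : ∀ a ∈ goodU, a ∈ K a := fun a ha => mem_connectedComponentIn ha
  have hβK : ∀ a ∈ goodU, β (K a) ∈ K a := fun a ha => hβ _ ⟨a, hKm a ha⟩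
  have hΦK := fun a (ha : a ∈ goodU) => hΦ (K a) (hKp a) (hKo a) (hKsub a) (hβK a ha)
  have heK := fun a (ha : a ∈ goodU) => he (β (K a)) (hKsub a (hβK a ha))
  have hecl : ∀ a ∈ goodU, ∀ ξ ∈ closure (chiV a₀), e (β (K a)) ξ ∈ closure (chiV (β (K a))) := by
    intro a ha ξ hξ
    by_cases h : ξ ∈ chiV a₀
    · obtain ⟨u, hu, rfl⟩ := h
      rw [(heK a ha).2.2 u hu]
      exact subset_closure ⟨u, hu, rfl⟩
    · have h1 : ξ ∈ frontier (chiV a₀) := by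
        rw [(isOpen_chiV ha₀).frontier_eq]; exact ⟨hξ, h⟩
      exact frontier_subset_closure ((heK a ha).2.1.mapsTo h1)
  refine ⟨fun a ξ => Φ (K a) a (e (β (K a)) ξ), ?_, ?_, ?_⟩
  · intro ξ hξ
    have hb : β (K a₀) = a₀ := hβ0 _ (hKm a₀ ha₀)
    have h1 := (heK a₀ ha₀).1 hb.symm
    have h2 := (hΦK a₀ ha₀).1 ξ (by rw [hb]; exact hξ)
    rw [hb] at h2
    simp only [h1, id_eq]
    exact h2
  · intro ξ hξ a ha
    have h1 := ((hΦK a ha).2.1 _ (hecl a ha ξ hξ)).differentiableAt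
      ((hKo a).mem_nhds (hKm a ha))
    refine (h1.congr_of_eventuallyEq ?_).differentiableWithinAt
    filter_upwards [(hKo a).mem_nhds (hKm a ha)] with b hb
    have hKab : K b = K a := (connectedComponentIn_eq hb).symm
    simp only [hKab]
  · intro a ha
    obtain ⟨h1, h2⟩ := (hΦK a ha).2.2 a (hKm a ha)
    refine ⟨h1.comp (heK a ha).2.1, fun u hu => ?_⟩
    simp only [(heK a ha).2.2 u hu, h2 u hu]

lemma coe_mem_Ainf {a z : ℂ} (ha : a ∈ goodU) : (z : RSphere) ∈ Ainf a ↔ z ≠ 0 ∧ z⁻¹ ∈ chiV a :=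
  (chi_bpair ha).elim fun _ h => h.coe_mem_Ainf_iff

lemma isOpen_Ainf {a : ℂ} (ha : a ∈ goodU) : IsOpen (Ainf a) := by
  obtain ⟨Y, h⟩ := chi_bpair ha
  rw [h.Ainf_eq]
  exact isOpen_sinv_image (isOpen_chiV ha)

lemma coe_mem_closure {a z : ℂ} (ha : a ∈ goodU) :
    (z : RSphere) ∈ closure (Ainf a) ↔ z ≠ 0 ∧ z⁻¹ ∈ closure (chiV a) := by
  have h1 : (z : RSphere) ∈ closure (Ainf a) ↔
      z ∈ closure ((fun w : ℂ => (w : RSphere)) ⁻¹' Ainf a) := by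
    rw [← OnePoint.isOpenEmbedding_coe.isOpenMap.preimage_closure_eq_closure_preimage
      OnePoint.continuous_coe]
    rfl
  rw [h1]
  constructor
  · intro h
    obtain ⟨x, hx, hxt⟩ := mem_closure_iff_seq_limit.1 h
    have hx' : ∀ n, x n ≠ 0 ∧ (x n)⁻¹ ∈ chiV a := fun n => (coe_mem_Ainf ha).1 (hx n)
    obtain ⟨M, hM0, hM⟩ := chiV_bound ha
    have hz : M⁻¹ ≤ ‖z‖ := by
      refine ge_of_tendsto hxt.norm (Eventually.of_forall fun n => ?_)
      have := hM _ (hx' n).2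
      rw [norm_inv] at this
      exact inv_le_of_inv_le₀ (norm_pos_iff.2 (hx' n).1) this
    have hz0 : z ≠ 0 := norm_pos_iff.1 ((inv_pos.2 hM0).trans_le hz)
    exact ⟨hz0, mem_closure_of_tendsto (hxt.inv₀ hz0) (Eventually.of_forall fun n => (hx' n).2)⟩
  · rintro ⟨hz0, hz⟩
    obtain ⟨w, hw, hwt⟩ := mem_closure_iff_seq_limit.1 hz
    have hi := hwt.inv₀ (inv_ne_zero hz0)
    rw [inv_inv] at hi
    refine mem_closure_of_tendsto hi ?_
    filter_upwards [hwt.eventually_ne (inv_ne_zero hz0)] with n hn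
    refine (coe_mem_Ainf ha).2 ⟨inv_ne_zero hn, ?_⟩
    rw [inv_inv]
    exact hw n

lemma coe_mem_frontier {a z : ℂ} (ha : a ∈ goodU) :
    (z : RSphere) ∈ frontier (Ainf a) ↔ z ≠ 0 ∧ z⁻¹ ∈ frontier (chiV a) := by
  rw [(isOpen_Ainf ha).frontier_eq, (isOpen_chiV ha).frontier_eq, Set.mem_sdiff, Set.mem_sdiff,
    coe_mem_closure ha, coe_mem_Ainf ha]
  tauto

theorem final_motion (a₀ : ℂ) (ha₀ : a₀ ∈ goodU) :
    ∃ φ : ℂ → ℂ → ℂ,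
      (∀ z : ℂ, (z : RSphere) ∈ closure (Ainf a₀) → φ a₀ z = z) ∧
      (∀ z : ℂ, (z : RSphere) ∈ closure (Ainf a₀) →
        DifferentiableOn ℂ (fun a => φ a z) goodU) ∧
      (∀ a ∈ goodU,
        Set.InjOn (φ a) {z : ℂ | (z : RSphere) ∈ closure (Ainf a₀)}) ∧
      (∀ a ∈ goodU,
        φ a '' {z : ℂ | (z : RSphere) ∈ Ainf a₀} = {z : ℂ | (z : RSphere) ∈ Ainf a} ∧
        φ a '' {z : ℂ | (z : RSphere) ∈ frontier (Ainf a₀)} =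
          {z : ℂ | (z : RSphere) ∈ frontier (Ainf a)}) := by
  obtain ⟨Ψ, hid, hdiff, hΨ⟩ := global_motion ha₀
  have h00 : ∀ a ∈ goodU, chi a 0 = 0 := fun a ha => (chi_bpair ha).elim fun _ h => h.X0
  have hm0 : (0 : ℂ) ∈ ball (0 : ℂ) 1 := mem_ball_self one_pos
  have hdisj : ∀ a ∈ goodU, ∀ w ∈ frontier (chiV a), w ∉ chiV a := by
    intro a ha w hw
    rw [(isOpen_chiV ha).frontier_eq] at hw
    exact hw.2
  have hcases : ∀ ξ ∈ closure (chiV a₀), ξ ∈ frontier (chiV a₀) ∨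
      ∃ u ∈ ball (0 : ℂ) 1, ξ = chi a₀ u := by
    intro ξ hξ
    by_cases h : ξ ∈ chiV a₀
    · obtain ⟨u, hu, rfl⟩ := h
      exact Or.inr ⟨u, hu, rfl⟩
    · left
      rw [(isOpen_chiV ha₀).frontier_eq]; exact ⟨hξ, h⟩
  have hinj : ∀ a ∈ goodU, Set.InjOn (Ψ a) (closure (chiV a₀)) := by
    intro a ha ξ hξ ξ' hξ' h
    rcases hcases ξ hξ with h1 | ⟨u, hu, rfl⟩ <;> rcases hcases ξ' hξ' with h2 | ⟨v, hv, rfl⟩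
    · exact (hΨ a ha).1.injOn h1 h2 h
    · rw [(hΨ a ha).2 v hv] at h
      exact absurd ⟨v, hv, h.symm⟩ (hdisj a ha _ ((hΨ a ha).1.mapsTo h1))
    · rw [(hΨ a ha).2 u hu] at h
      exact absurd ⟨u, hu, h⟩ (hdisj a ha _ ((hΨ a ha).1.mapsTo h2))
    · rw [(hΨ a ha).2 u hu, (hΨ a ha).2 v hv] at h
      rw [chi_injOn ha hu hv h]
  have hz0 : ∀ a ∈ goodU, ∀ ξ ∈ closure (chiV a₀), ξ ≠ 0 → Ψ a ξ ≠ 0 := by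
    intro a ha ξ hξ hne h
    refine hne (hinj a ha hξ (subset_closure (zero_mem_chiV ha₀)) ?_)
    have := (hΨ a ha).2 0 hm0
    rw [h00 a₀ ha₀, h00 a ha] at this
    rw [h, this]
  refine ⟨fun a z => (Ψ a z⁻¹)⁻¹, ?_, ?_, ?_, fun a ha => ⟨?_, ?_⟩⟩
  · intro z hz
    have hz' := (coe_mem_closure ha₀).1 hz
    simp only [hid _ hz'.2, inv_inv]
  · intro z hz
    have hz' := (coe_mem_closure ha₀).1 hz
    exact (hdiff _ hz'.2).fun_inv fun a ha => hz0 a ha _ hz'.2 (inv_ne_zero hz'.1)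
  · intro a ha z hz z' hz' h
    have h1 := (coe_mem_closure ha₀).1 hz
    have h2 := (coe_mem_closure ha₀).1 hz'
    exact inv_injective (hinj a ha h1.2 h2.2 (inv_injective h))
  · ext w
    constructor
    · rintro ⟨z, hz, rfl⟩
      have hz' := (coe_mem_Ainf ha₀).1 hz
      refine (coe_mem_Ainf ha).2 ⟨inv_ne_zero (hz0 a ha _ (subset_closure hz'.2)
        (inv_ne_zero hz'.1)), ?_⟩
      obtain ⟨u, hu, hue⟩ := hz'.2
      simp only [← hue, inv_inv, (hΨ a ha).2 u hu]
      exact ⟨u, hu, rfl⟩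
    · intro hw
      obtain ⟨hw0, u, hu, hue⟩ := (coe_mem_Ainf ha).1 hw
      refine ⟨(chi a₀ u)⁻¹, (coe_mem_Ainf ha₀).2 ⟨inv_ne_zero fun h => ?_, ?_⟩, ?_⟩
      · rw [← h00 a₀ ha₀] at h
        have := chi_injOn ha₀ hu hm0 h
        rw [this, h00 a ha] at hue
        exact inv_ne_zero hw0 hue.symm
      · rw [inv_inv]; exact ⟨u, hu, rfl⟩
      · simp only [inv_inv, (hΨ a ha).2 u hu, hue]
  · ext w
    constructor
    · rintro ⟨z, hz, rfl⟩
      have hz' := (coe_mem_frontier ha₀).1 hz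
      refine (coe_mem_frontier ha).2 ⟨inv_ne_zero (hz0 a ha _ (frontier_subset_closure hz'.2)
        (inv_ne_zero hz'.1)), ?_⟩
      simp only [inv_inv]
      exact (hΨ a ha).1.mapsTo hz'.2
    · intro hw
      obtain ⟨hw0, hwf⟩ := (coe_mem_frontier ha).1 hw
      obtain ⟨ξ, hξ, hξe⟩ := (hΨ a ha).1.surjOn hwf
      refine ⟨ξ⁻¹, (coe_mem_frontier ha₀).2 ⟨inv_ne_zero fun h => ?_, ?_⟩, ?_⟩
      · rw [h] at hξ
        exact hdisj a₀ ha₀ 0 hξ (zero_mem_chiV ha₀)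
      · rw [inv_inv]; exact hξ
      · simp only [inv_inv, hξe]

/-- Over `U = {a ≠ 0 : a ∉ closure P_∞}`, the closure of `A_∞` moves holomorphically:
there is a motion `φ` which is the identity at the base point `a₀`, is holomorphic in the
parameter, injective in the space variable, and carries `A_∞(a₀) ∖ {∞}` onto `A_∞(a) ∖ {∞}`
and the frontier of `A_∞(a₀)` onto the frontier of `A_∞(a)`. -/
theorem closure_Ainf_moves_holomorphically (a₀ : ℂ) (ha₀ : a₀ ≠ 0)
    (ha₀' : a₀ ∉ closure Pinf) :
    ∃ φ : ℂ → ℂ → ℂ,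
      (∀ z : ℂ, (z : RSphere) ∈ closure (Ainf a₀) → φ a₀ z = z) ∧
      (∀ z : ℂ, (z : RSphere) ∈ closure (Ainf a₀) →
        DifferentiableOn ℂ (fun a => φ a z) {a : ℂ | a ≠ 0 ∧ a ∉ closure Pinf}) ∧
      (∀ a ∈ {a : ℂ | a ≠ 0 ∧ a ∉ closure Pinf},
        Set.InjOn (φ a) {z : ℂ | (z : RSphere) ∈ closure (Ainf a₀)}) ∧
      (∀ a ∈ {a : ℂ | a ≠ 0 ∧ a ∉ closure Pinf},
        φ a '' {z : ℂ | (z : RSphere) ∈ Ainf a₀} = {z : ℂ | (z : RSphere) ∈ Ainf a} ∧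
        φ a '' {z : ℂ | (z : RSphere) ∈ frontier (Ainf a₀)} =
          {z : ℂ | (z : RSphere) ∈ frontier (Ainf a)}) := by
  exact final_motion a₀ ⟨ha₀, ha₀'⟩
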